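/- Let [a,b] ⊂ ℝ be compact, f₀ a probability density on [a,b] with f₀ > 0 and TV(log f₀) < ∞, and let x₁,...,xₙ be i.i.d. with density f₀. Let F be the class of probability densities f on [a,b] with f > 0 and TV(log f) < ∞, and for f ∈ F set p_f = (1/2) log((f + f₀)/(2f₀)) and J(f) = 1 + TV(log f) + TV(log f₀). Then there exist constants c, n₀, t₀ such that for all n ≥ n₀ and all T ≥ t₀, the outer probability that sup over {f ∈ F : h(f, f₀) > n^{−1/3} J(f)} of |√n (P_n − P)(p_f)| / (h^{1/2}(f, f₀) · J^{1/2}(f)) is at least T is at most c·exp(−T/c²), where P_n(g) = (1/n)Σᵢ g(xᵢ) and P(g) = ∫ g f₀ dx. -/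

import Mathlib

open MeasureTheory Set

/-- membership in the class `F` of probability densities on `[a,b]` that are
positive with log of bounded variation. -/
def InF (a b : ℝ) (f : ℝ → ℝ) : Prop :=
  (∀ t ∈ Set.Icc a b, 0 < f t) ∧
    MeasureTheory.IntegrableOn f (Set.Icc a b) ∧
    (∫ t in Set.Icc a b, f t) = 1 ∧
    eVariationOn (fun t => Real.log (f t)) (Set.Icc a b) ≠ ⊤

/-- `J(f) = 1 + TV(log f) + TV(log f₀)` on `[a,b]`. -/
noncomputable def Jfun (a b : ℝ) (f₀ f : ℝ → ℝ) : ℝ :=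
  1 + (eVariationOn (fun t => Real.log (f t)) (Set.Icc a b)).toReal
    + (eVariationOn (fun t => Real.log (f₀ t)) (Set.Icc a b)).toReal

/-- Hellinger distance `h(f,g) = ((1/2)∫ₐᵇ(√f-√g)²)^{1/2}`. -/
noncomputable def hell (a b : ℝ) (f g : ℝ → ℝ) : ℝ :=
  Real.sqrt ((1 / 2) * ∫ t in Set.Icc a b, (Real.sqrt (f t) - Real.sqrt (g t)) ^ 2)

/-- `p_f = (1/2) log((f + f₀)/(2 f₀))`. -/
noncomputable def pfun (f₀ f : ℝ → ℝ) : ℝ → ℝ :=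
  fun t => (1 / 2) * Real.log ((f t + f₀ t) / (2 * f₀ t))

/-- the centered empirical process `(Pₙ - P)(g)` from the first `n` points of
the sample `X`, where `P(g) = ∫ₐᵇ g f₀`. -/
noncomputable def empProc {Ω : Type*} (a b : ℝ) (f₀ : ℝ → ℝ) (n : ℕ)
    (X : ℕ → Ω → ℝ) (g : ℝ → ℝ) (ω : Ω) : ℝ :=
  (1 / (n : ℝ)) * ∑ i ∈ Finset.range n, g (X i ω)
    - ∫ t in Set.Icc a b, g t * f₀ t

section Elementary

lemma exists_add_two_pow_eight_le : ∃ C > (0 : ℝ), ∀ k : ℕ, ((k : ℝ) + 2) ^ 8 ≤ C * √2 ^ k := by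
  have hb : (1 : ℝ) < √2 := by
    rw [Real.lt_sqrt] <;> norm_num
  obtain ⟨M, hM⟩ := (tendsto_pow_const_div_const_pow_of_one_lt 8 hb).bddAbove_range
  refine ⟨2 * max M 1, by positivity, fun k => ?_⟩
  have h := hM ⟨k + 2, rfl⟩
  have hp : (0 : ℝ) < √2 ^ (k + 2) := by positivity
  simp only at h
  rw [div_le_iff₀ hp] at h
  push_cast at h
  have h2 : √2 ^ (k + 2) = 2 * √2 ^ k := by
    rw [pow_add, Real.sq_sqrt (by norm_num)]; ring
  rw [h2] at h
  calc ((k : ℝ) + 2) ^ 8 ≤ M * (2 * √2 ^ k) := h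
    _ ≤ max M 1 * (2 * √2 ^ k) := by gcongr; exact le_max_left _ _
    _ = _ := by ring

/-- On `[0, T(k+1)]` the eighth power is controlled by the soft threshold
`log (1 + 2^{-k/2} e^x)`. -/
lemma exists_pow_eight_le_log : ∃ C > (0 : ℝ), ∀ (k : ℕ) (T x : ℝ), 1 ≤ T → 0 ≤ x →
    x ≤ T * (k + 1) →
    x ^ 8 ≤ C * √2 ^ k * T ^ 7 * Real.log (1 + Real.exp x / √2 ^ k) := by
  obtain ⟨C, hC, hk⟩ := exists_add_two_pow_eight_le
  refine ⟨60480 + 2 * C, by positivity, fun k T x hT hx hxT => ?_⟩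
  set b : ℝ := √2 ^ k with hb
  have hbpos : 0 < b := by positivity
  set y := Real.exp x / b with hy
  have hypos : 0 < y := by positivity
  have hlog : 2 * y / (y + 2) ≤ Real.log (1 + y) := Real.le_log_one_add_of_nonneg hypos.le
  have hlogpos : 0 ≤ Real.log (1 + y) := Real.log_nonneg (by linarith)
  have hT7 : 1 ≤ T ^ 7 := one_le_pow₀ hT
  rcases le_total y 1 with h1 | h1
  · have h3 : y ≤ 3 / 2 * Real.log (1 + y) := by
      rw [div_le_iff₀ (by linarith)] at hlog
      nlinarith
    have h4 := Real.pow_div_factorial_le_exp x hx 8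
    have h5 : x ^ 8 ≤ 40320 * (b * y) := by
      have : b * y = Real.exp x := by rw [hy]; field_simp
      rw [this]
      norm_num [Nat.factorial] at h4
      linarith
    calc x ^ 8 ≤ 40320 * (b * y) := h5
      _ ≤ 40320 * (b * (3 / 2 * Real.log (1 + y))) := by gcongr
      _ = 60480 * b * 1 * Real.log (1 + y) := by ring
      _ ≤ (60480 + 2 * C) * b * T ^ 7 * Real.log (1 + y) := by
        gcongr
        linarith
  · have h2 : 2 / 3 ≤ Real.log (1 + y) := by
      refine le_trans ?_ hlog
      rw [div_le_div_iff₀ (by norm_num) (by linarith)]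
      linarith
    have hlb : Real.log b ≤ k := by
      rw [hb, Real.log_pow]
      have : Real.log √2 ≤ 1 := by
        rw [Real.log_sqrt (by norm_num)]
        linarith [Real.log_two_lt_d9]
      nlinarith [Nat.cast_nonneg (α := ℝ) k]
    have h3 : x - k ≤ Real.log (1 + y) := by
      have : Real.log y = x - Real.log b := by
        rw [hy, Real.log_div (Real.exp_pos x).ne' hbpos.ne', Real.log_exp]
      have h' : Real.log y ≤ Real.log (1 + y) := Real.log_le_log hypos (by linarith)
      linarith
    have h4 : x ≤ 2 * (k + 2) * Real.log (1 + y) := by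
      have := Nat.cast_nonneg (α := ℝ) k
      nlinarith
    have h5 : x ^ 7 ≤ T ^ 7 * (k + 2) ^ 7 := by
      rw [← mul_pow]
      gcongr
      nlinarith
    calc x ^ 8 = x ^ 7 * x := by ring
      _ ≤ (T ^ 7 * (k + 2) ^ 7) * (2 * (k + 2) * Real.log (1 + y)) := by gcongr
      _ = 2 * (k + 2) ^ 8 * T ^ 7 * Real.log (1 + y) := by ring
      _ ≤ 2 * (C * b) * T ^ 7 * Real.log (1 + y) := by gcongr; exact hk k
      _ = 2 * C * b * T ^ 7 * Real.log (1 + y) := by ring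
      _ ≤ (60480 + 2 * C) * b * T ^ 7 * Real.log (1 + y) := by
        gcongr
        linarith

lemma sum_mul_le_of_pow_eight {ι : Type*} (s : Finset ι) (c α : ι → ℝ) {A D M l : ℝ}
    (hl : 0 < l) (hc : ∀ i ∈ s, 0 ≤ c i) (hα : ∀ i ∈ s, 0 ≤ α i) (hA : ∑ i ∈ s, c i ≤ A)
    (hD0 : 0 ≤ D) (hM0 : 0 ≤ M)
    (hD : ∑ i ∈ s, c i ^ 2 ≤ D ^ 2) (hM : ∑ i ∈ s, α i ^ 8 ≤ M ^ 2) :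
    ∑ i ∈ s, c i * α i ≤ l * A + D * M / l ^ 3 := by
  have hpt : ∀ x : ℝ, 0 ≤ x → x ≤ l + x ^ 4 / l ^ 3 := by
    intro x hx
    rcases le_total x l with h | h
    · have : 0 ≤ x ^ 4 / l ^ 3 := by positivity
      linarith
    · have : x ≤ x ^ 4 / l ^ 3 := by
        rw [le_div_iff₀ (by positivity)]
        calc x * l ^ 3 ≤ x * x ^ 3 := by gcongr
          _ = x ^ 4 := by ring
      linarith
  have hCS : ∑ i ∈ s, c i * α i ^ 4 ≤ D * M := by
    refine abs_le_of_sq_le_sq' ?_ (by positivity) |>.2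
    calc (∑ i ∈ s, c i * α i ^ 4) ^ 2 ≤ (∑ i ∈ s, c i ^ 2) * ∑ i ∈ s, (α i ^ 4) ^ 2 :=
          Finset.sum_mul_sq_le_sq_mul_sq _ _ _
      _ = (∑ i ∈ s, c i ^ 2) * ∑ i ∈ s, α i ^ 8 := by simp only [← pow_mul]
      _ ≤ D ^ 2 * M ^ 2 := by
        gcongr
      _ = (D * M) ^ 2 := by ring
  calc ∑ i ∈ s, c i * α i ≤ ∑ i ∈ s, (l * c i + c i * α i ^ 4 / l ^ 3) := by
        refine Finset.sum_le_sum fun i hi => ?_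
        have := mul_le_mul_of_nonneg_left (hpt _ (hα i hi)) (hc i hi)
        calc _ ≤ _ := this
          _ = _ := by ring
    _ = l * ∑ i ∈ s, c i + (∑ i ∈ s, c i * α i ^ 4) / l ^ 3 := by
        rw [Finset.sum_add_distrib, Finset.mul_sum, Finset.sum_div]
    _ ≤ _ := by gcongr

/-- Two-sided geometric sums are bounded, uniformly in the location of the peak. -/
lemma sum_min_inv_le {β ε : ℝ} (hβ : 1 < β) (hε : 0 < ε) (K : ℕ) :
    ∑ k ∈ Finset.range K, min (ε * β ^ k) (ε * β ^ k)⁻¹ ≤ 2 * (1 + β) / (β - 1) := by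
  set Φ : ℕ → ℝ := fun k => ε * β ^ k / (1 + ε * β ^ k) with hΦ
  have hβ0 : 0 < β - 1 := by linarith
  have hstep : ∀ k, min (ε * β ^ k) (ε * β ^ k)⁻¹ ≤ 2 * (1 + β) / (β - 1) * (Φ (k + 1) - Φ k) := by
    intro k
    set y := ε * β ^ k with hy
    have hy0 : 0 < y := by positivity
    have e : Φ (k + 1) - Φ k = (β - 1) * y / ((1 + y) * (1 + β * y)) := by
      have h1 : Φ (k + 1) = β * y / (1 + β * y) := by simp only [hΦ, hy, pow_succ]; ring_nf
      have h2 : Φ k = y / (1 + y) := rfl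
      have : 0 < 1 + β * y := by positivity
      rw [h1, h2]
      field_simp
      ring
    rw [e]
    have e2 : 2 * (1 + β) / (β - 1) * ((β - 1) * y / ((1 + y) * (1 + β * y)))
        = 2 * (1 + β) * y / ((1 + y) * (1 + β * y)) := by
      have : 0 < 1 + β * y := by positivity
      field_simp
    rw [e2]
    have hp : 0 < (1 + y) * (1 + β * y) := by positivity
    rcases le_total y 1 with h | h
    · refine (min_le_left _ _).trans ?_
      rw [le_div_iff₀ hp]
      have : (1 + y) * (1 + β * y) ≤ 2 * (1 + β) := by
        gcongr
        · linarith
        · nlinarith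
      nlinarith
    · refine (min_le_right _ _).trans ?_
      rw [le_div_iff₀ hp, inv_mul_le_iff₀ hy0]
      have : (1 + y) * (1 + β * y) ≤ (2 * y) * ((1 + β) * y) := by
        gcongr
        · linarith
        · nlinarith
      nlinarith
  calc _ ≤ ∑ k ∈ Finset.range K, 2 * (1 + β) / (β - 1) * (Φ (k + 1) - Φ k) :=
        Finset.sum_le_sum fun k _ => hstep k
    _ = 2 * (1 + β) / (β - 1) * (Φ K - Φ 0) := by rw [← Finset.mul_sum, Finset.sum_range_sub]
    _ ≤ 2 * (1 + β) / (β - 1) * 1 := by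
        gcongr
        have h1 : Φ K ≤ 1 := by
          simp only [hΦ]
          rw [div_le_one (by positivity)]
          linarith
        have h2 : 0 ≤ Φ 0 := by simp only [hΦ]; positivity
        linarith
    _ = _ := by ring

lemma succ_pow_three_le (K : ℕ) : ((K : ℝ) + 1) ^ 3 ≤ 8 * 2 ^ K := by
  have h : ∀ m : ℕ, (m + 4) ^ 3 ≤ 8 * 2 ^ (m + 3) := by
    intro m
    induction m with
    | zero => norm_num
    | succ m ih =>
      have e : 8 * 2 ^ (m + 1 + 3) = 2 * (8 * 2 ^ (m + 3)) := by ring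
      rw [e]
      nlinarith [Nat.zero_le m, Nat.zero_le (m ^ 2), Nat.zero_le (m ^ 3)]
  have h' : (K + 1) ^ 3 ≤ 8 * 2 ^ K := by
    rcases lt_or_ge K 3 with h3 | h3
    · interval_cases K <;> norm_num
    · obtain ⟨m, rfl⟩ := Nat.exists_eq_add_of_le' h3
      exact h m
  exact_mod_cast h'

lemma half_log_ratio_sq_mul_le {f g : ℝ} (hf : 0 < f) (hg : 0 < g) :
    (1 / 2 * Real.log ((f + g) / (2 * g))) ^ 2 * g ≤ 4 * (√f - √g) ^ 2 := by
  set u := √f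
  set v := √g
  have hu : 0 < u := Real.sqrt_pos.2 hf
  have hv : 0 < v := Real.sqrt_pos.2 hg
  have hfu : f = u ^ 2 := (Real.sq_sqrt hf.le).symm
  have hgv : g = v ^ 2 := (Real.sq_sqrt hg.le).symm
  rw [hfu, hgv]
  set p := 1 / 2 * Real.log ((u ^ 2 + v ^ 2) / (2 * v ^ 2)) with hp
  suffices h : |p| * v ≤ |u - v| by
    have h0 : 0 ≤ |p| * v := by positivity
    calc p ^ 2 * v ^ 2 = (|p| * v) ^ 2 := by rw [mul_pow |p|, sq_abs]
      _ ≤ |u - v| ^ 2 := by gcongr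
      _ = (u - v) ^ 2 := sq_abs _
      _ ≤ _ := by nlinarith [sq_nonneg (u - v)]
  rcases le_total v u with h | h
  · have hp0 : 0 ≤ p := by
      refine mul_nonneg (by norm_num) (Real.log_nonneg ?_)
      rw [le_div_iff₀ (by positivity)]
      nlinarith
    rw [abs_of_nonneg hp0, abs_of_nonneg (by linarith)]
    have h1 : p ≤ Real.log (u / v) := by
      have : Real.log ((u ^ 2 + v ^ 2) / (2 * v ^ 2)) ≤ Real.log ((u / v) ^ 2) := by
        apply Real.log_le_log (by positivity)
        rw [div_pow, div_le_div_iff₀ (by positivity) (by positivity)]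
        have : v ^ 2 ≤ u ^ 2 := by gcongr
        nlinarith [sq_nonneg v]
      rw [Real.log_pow] at this
      push_cast at this
      linarith
    have h2 := Real.log_le_sub_one_of_pos (show 0 < u / v by positivity)
    have h3 : (u / v - 1) * v = u - v := by field_simp
    nlinarith
  · have hp0 : p ≤ 0 := by
      refine mul_nonpos_of_nonneg_of_nonpos (by norm_num) (Real.log_nonpos (by positivity) ?_)
      rw [div_le_iff₀ (by positivity)]
      nlinarith
    rw [abs_of_nonpos hp0, abs_of_nonpos (by linarith)]
    have h2 := Real.log_le_sub_one_of_pos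
      (show 0 < ((u ^ 2 + v ^ 2) / (2 * v ^ 2))⁻¹ by positivity)
    rw [Real.log_inv, inv_div] at h2
    have h3 : -p ≤ 1 / 2 * ((2 * v ^ 2) / (u ^ 2 + v ^ 2) - 1) := by linarith
    have h4 : 1 / 2 * ((2 * v ^ 2) / (u ^ 2 + v ^ 2) - 1) * v ≤ v - u := by
      have : 1 / 2 * ((2 * v ^ 2) / (u ^ 2 + v ^ 2) - 1) * v
          = (v - u) * ((v + u) * v) / (2 * (u ^ 2 + v ^ 2)) := by field_simp; ring
      rw [this, div_le_iff₀ (by positivity)]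
      apply mul_le_mul_of_nonneg_left _ (by linarith)
      nlinarith
    nlinarith

lemma abs_half_log_ratio_sub_le {f g f' g' : ℝ} (hf : 0 < f) (hg : 0 < g) (hf' : 0 < f')
    (hg' : 0 < g') :
    |1 / 2 * Real.log ((f + g) / (2 * g)) - 1 / 2 * Real.log ((f' + g') / (2 * g'))| ≤
      1 / 2 * (|Real.log f - Real.log f'| + |Real.log g - Real.log g'|) := by
  have key : ∀ {f g f' g' : ℝ}, 0 < f → 0 < g → 0 < f' → 0 < g' →
      Real.log ((f + g) / (2 * g)) - Real.log ((f' + g') / (2 * g')) ≤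
        |Real.log f - Real.log f'| + |Real.log g - Real.log g'| := by
    intro f g f' g' hf hg hf' hg'
    set A := |Real.log f - Real.log f'|
    set B := |Real.log g - Real.log g'|
    have h1 : f ≤ Real.exp A * f' := by
      rw [← Real.log_le_log_iff hf (by positivity), Real.log_mul (by positivity) hf'.ne',
        Real.log_exp]
      linarith [le_abs_self (Real.log f - Real.log f')]
    have h2 : g' ≤ Real.exp B * g := by
      rw [← Real.log_le_log_iff hg' (by positivity), Real.log_mul (by positivity) hg.ne',
        Real.log_exp]
      linarith [neg_abs_le (Real.log g - Real.log g')]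
    have h3 : (f + g) / (2 * g) ≤ Real.exp (A + B) * ((f' + g') / (2 * g')) := by
      rw [← mul_div_assoc, div_le_div_iff₀ (by positivity) (by positivity), Real.exp_add]
      have hA : 1 ≤ Real.exp A := Real.one_le_exp (abs_nonneg _)
      have hB : 1 ≤ Real.exp B := Real.one_le_exp (abs_nonneg _)
      have h5 : f * g' ≤ (Real.exp A * f') * (Real.exp B * g) := by gcongr
      have h6 : g * g' ≤ (Real.exp A * Real.exp B) * (g * g') := by
        have : 1 ≤ Real.exp A * Real.exp B := one_le_mul_of_one_le_of_one_le hA hB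
        have : 0 < g * g' := by positivity
        nlinarith
      nlinarith
    have h4 := Real.log_le_log (by positivity) h3
    rw [Real.log_mul (by positivity) (by positivity), Real.log_exp] at h4
    linarith
  rw [← mul_sub, abs_mul, abs_of_pos (by norm_num : (0 : ℝ) < 1 / 2)]
  gcongr
  rw [abs_le]
  constructor
  · have := key hf' hg' hf hg
    rw [abs_sub_comm (Real.log f'), abs_sub_comm (Real.log g')] at this
    linarith
  · exact key hf hg hf' hg'

end Elementary

section ExponentialMoments

variable {Ω : Type*} [MeasurableSpace Ω] {ℙ : Measure Ω} [IsProbabilityMeasure ℙ]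
  {μ : Measure ℝ} {X : ℕ → Ω → ℝ}

lemma isProbabilityMeasure_of_map_eq (hXmeas : ∀ i, Measurable (X i))
    (hXlaw : ∀ i, Measure.map (X i) ℙ = μ) : IsProbabilityMeasure μ := by
  rw [← hXlaw 0]
  exact Measure.isProbabilityMeasure_map (hXmeas 0).aemeasurable

lemma integrable_exp_sum (hXmeas : ∀ i, Measurable (X i)) {g : ℝ → ℝ} (hg : Measurable g)
    (hg1 : ∀ x, |g x| ≤ 1) (n : ℕ) :
    Integrable (fun ω => Real.exp (∑ i ∈ Finset.range n, g (X i ω))) ℙ := by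
  refine Integrable.of_bound (C := Real.exp n) ?_ (Filter.Eventually.of_forall fun ω => ?_)
  · exact (Real.measurable_exp.comp
      (Finset.measurable_sum _ fun i _ => hg.comp (hXmeas i))).aestronglyMeasurable
  · rw [Real.norm_eq_abs, Real.abs_exp, Real.exp_le_exp]
    calc ∑ i ∈ Finset.range n, g (X i ω) ≤ ∑ i ∈ Finset.range n, (1 : ℝ) :=
          Finset.sum_le_sum fun i _ => (abs_le.1 (hg1 _)).2
      _ = n := by simp

/-- Exponential moment bound for sums of bounded functions of an i.i.d. sample. -/
lemma integral_exp_sum_le (hXmeas : ∀ i, Measurable (X i))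
    (hXlaw : ∀ i, Measure.map (X i) ℙ = μ)
    (hXindep : ProbabilityTheory.iIndepFun (m := fun _ => Real.measurableSpace) X ℙ)
    {g : ℝ → ℝ} (hg : Measurable g) (hg1 : ∀ x, |g x| ≤ 1) (n : ℕ) :
    ∫ ω, Real.exp (∑ i ∈ Finset.range n, g (X i ω)) ∂ℙ ≤
      Real.exp (n * (∫ x, g x ∂μ + ∫ x, g x ^ 2 ∂μ)) := by
  have : IsProbabilityMeasure μ := isProbabilityMeasure_of_map_eq hXmeas hXlaw
  have hone : ∫ x, Real.exp (g x) ∂μ ≤ Real.exp (∫ x, g x ∂μ + ∫ x, g x ^ 2 ∂μ) := by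
    have i1 : Integrable g μ :=
      Integrable.of_bound hg.aestronglyMeasurable 1 (Filter.Eventually.of_forall hg1)
    have i2 : Integrable (fun x => g x ^ 2) μ := by
      refine Integrable.of_bound (hg.pow_const 2).aestronglyMeasurable 1
        (Filter.Eventually.of_forall fun x => ?_)
      rw [Real.norm_eq_abs, abs_pow]
      exact pow_le_one₀ (abs_nonneg _) (hg1 x)
    have i3 : Integrable (fun x => Real.exp (g x)) μ := by
      refine Integrable.of_bound (Real.measurable_exp.comp hg).aestronglyMeasurable (Real.exp 1)
        (Filter.Eventually.of_forall fun x => ?_)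
      rw [Real.norm_eq_abs, Real.abs_exp, Real.exp_le_exp]
      exact (abs_le.1 (hg1 x)).2
    calc ∫ x, Real.exp (g x) ∂μ ≤ ∫ x, ((1 + g x) + g x ^ 2) ∂μ := by
          refine integral_mono i3 (((integrable_const 1).add i1).add i2) fun x => ?_
          have := (abs_le.1 (Real.abs_exp_sub_one_sub_id_le (hg1 x))).2
          simp only
          linarith
      _ = (∫ x, g x ∂μ + ∫ x, g x ^ 2 ∂μ) + 1 := by
          rw [integral_add (f := fun x => 1 + g x) ((integrable_const 1).add i1) i2,
            integral_add (integrable_const 1) i1]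
          simp
          ring
      _ ≤ _ := Real.add_one_le_exp _
  have hind : ProbabilityTheory.iIndepFun (fun i ω => g (X i ω)) ℙ :=
    hXindep.comp (fun _ => g) fun _ => hg
  have hmgf := hind.mgf_sum (t := 1) (fun i => hg.comp (hXmeas i)) (Finset.range n)
  simp only [ProbabilityTheory.mgf, one_mul, Finset.sum_apply] at hmgf
  rw [hmgf]
  have hlaw : ∀ i, ∫ ω, Real.exp (g (X i ω)) ∂ℙ = ∫ x, Real.exp (g x) ∂μ := by
    intro i
    rw [← hXlaw i, integral_map (hXmeas i).aemeasurable]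
    exact (Real.measurable_exp.comp hg).aestronglyMeasurable
  simp only [hlaw, Finset.prod_const, Finset.card_range]
  rw [Real.exp_nat_mul]
  exact pow_le_pow_left₀ (integral_nonneg fun x => (Real.exp_pos _).le) hone n

lemma sq_sum_of_mul_eq_zero {ι : Type*} [Fintype ι] {φ : ι → ℝ}
    (h : ∀ i j, i ≠ j → φ i * φ j = 0) : (∑ i, φ i) ^ 2 = ∑ i, φ i ^ 2 := by
  rw [sq, Finset.sum_mul_sum]
  refine Finset.sum_congr rfl fun i _ => ?_
  rw [Finset.sum_eq_single i (fun j _ hj => h i j hj.symm) (by simp), sq]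

lemma abs_sum_le_one_of_mul_eq_zero {ι : Type*} [Fintype ι] {φ : ι → ℝ}
    (h : ∀ i j, i ≠ j → φ i * φ j = 0) (h1 : ∀ i, |φ i| ≤ 1) : |∑ i, φ i| ≤ 1 := by
  by_cases hz : ∀ i, φ i = 0
  · simp [hz]
  · push Not at hz
    obtain ⟨i, hi⟩ := hz
    rw [Finset.sum_eq_single i _ (by simp)]
    · exact h1 i
    · intro j _ hj
      exact (mul_eq_zero.1 (h i j hj.symm)).resolve_left hi

variable {ι : Type*} [Fintype ι] {ψ : ι → ℝ → ℝ}

lemma integral_exp_signed_sum_le (hXmeas : ∀ i, Measurable (X i))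
    (hXlaw : ∀ i, Measure.map (X i) ℙ = μ)
    (hXindep : ProbabilityTheory.iIndepFun (m := fun _ => Real.measurableSpace) X ℙ)
    (hψ : ∀ j, Measurable (ψ j)) (hψ1 : ∀ j x, |ψ j x| ≤ 1)
    (hdisj : ∀ i j, i ≠ j → ∀ x, ψ i x * ψ j x = 0)
    (hmean : ∀ j, ∫ x, ψ j x ∂μ = 0) {n : ℕ} (hn : 0 < n)
    (hvar : ∀ j, ∫ x, ψ j x ^ 2 ∂μ ≤ 1 / n) {s : ι → ℝ} (hs : ∀ j, |s j| ≤ 1) :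
    Integrable (fun ω => Real.exp (∑ j, s j * ∑ i ∈ Finset.range n, ψ j (X i ω))) ℙ ∧
    ∫ ω, Real.exp (∑ j, s j * ∑ i ∈ Finset.range n, ψ j (X i ω)) ∂ℙ ≤
      Real.exp (∑ j, s j ^ 2) := by
  have : IsProbabilityMeasure μ := isProbabilityMeasure_of_map_eq hXmeas hXlaw
  set g : ℝ → ℝ := fun x => ∑ j, s j * ψ j x with hgdef
  have hg : Measurable g := Finset.measurable_sum _ fun j _ => (hψ j).const_mul _
  have hdisj' : ∀ x i j, i ≠ j → (s i * ψ i x) * (s j * ψ j x) = 0 := by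
    intro x i j hij
    rw [mul_mul_mul_comm, hdisj i j hij, mul_zero]
  have hg1 : ∀ x, |g x| ≤ 1 := fun x => abs_sum_le_one_of_mul_eq_zero (hdisj' x) fun i => by
    rw [abs_mul]
    exact mul_le_one₀ (hs i) (abs_nonneg _) (hψ1 i x)
  have hsum : ∀ ω, ∑ j, s j * ∑ i ∈ Finset.range n, ψ j (X i ω)
      = ∑ i ∈ Finset.range n, g (X i ω) := by
    intro ω
    simp only [hgdef, Finset.mul_sum]
    exact Finset.sum_comm
  simp only [hsum]
  refine ⟨integrable_exp_sum hXmeas hg hg1 n,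
    (integral_exp_sum_le hXmeas hXlaw hXindep hg hg1 n).trans (Real.exp_le_exp.2 ?_)⟩
  have i1 : ∀ j, Integrable (ψ j) μ := fun j =>
    Integrable.of_bound (hψ j).aestronglyMeasurable 1 (Filter.Eventually.of_forall (hψ1 j))
  have i2 : ∀ j, Integrable (fun x => ψ j x ^ 2) μ := fun j => by
    refine Integrable.of_bound ((hψ j).pow_const 2).aestronglyMeasurable 1
      (Filter.Eventually.of_forall fun x => ?_)
    rw [Real.norm_eq_abs, abs_pow]
    exact pow_le_one₀ (abs_nonneg _) (hψ1 j x)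
  have e1 : ∫ x, g x ∂μ = 0 := by
    simp only [hgdef]
    rw [integral_finsetSum _ fun j _ => (i1 j).const_mul _]
    simp [integral_const_mul, hmean]
  have e2 : ∫ x, g x ^ 2 ∂μ ≤ ∑ j, s j ^ 2 * (1 / n) := by
    have : ∀ x, g x ^ 2 = ∑ j, s j ^ 2 * ψ j x ^ 2 := fun x => by
      rw [hgdef]
      simp only
      rw [sq_sum_of_mul_eq_zero (hdisj' x)]
      simp only [mul_pow]
    simp only [this]
    rw [integral_finsetSum _ fun j _ => (i2 j).const_mul _]
    refine Finset.sum_le_sum fun j _ => ?_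
    rw [integral_const_mul]
    exact mul_le_mul_of_nonneg_left (hvar j) (sq_nonneg _)
  rw [e1, zero_add]
  have hn' : (0 : ℝ) < n := by exact_mod_cast hn
  calc (n : ℝ) * ∫ x, g x ^ 2 ∂μ ≤ n * ∑ j, s j ^ 2 * (1 / n) := by gcongr
    _ = ∑ j, s j ^ 2 := by
      rw [← Finset.sum_mul]
      field_simp

/-- The coordinates behave as if they were independent: the product of soft thresholds is
expanded into exponentials of signed sums. -/
lemma integral_prod_one_add_exp_le (hXmeas : ∀ i, Measurable (X i))
    (hXlaw : ∀ i, Measure.map (X i) ℙ = μ)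
    (hXindep : ProbabilityTheory.iIndepFun (m := fun _ => Real.measurableSpace) X ℙ)
    (hψ : ∀ j, Measurable (ψ j)) (hψ1 : ∀ j x, |ψ j x| ≤ 1)
    (hdisj : ∀ i j, i ≠ j → ∀ x, ψ i x * ψ j x = 0)
    (hmean : ∀ j, ∫ x, ψ j x ∂μ = 0) {n : ℕ} (hn : 0 < n)
    (hvar : ∀ j, ∫ x, ψ j x ^ 2 ∂μ ≤ 1 / n) {r : ℝ} (hr : 0 ≤ r) :
    Integrable (fun ω => ∏ j, (1 + r * (Real.exp (∑ i ∈ Finset.range n, ψ j (X i ω)) +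
      Real.exp (-∑ i ∈ Finset.range n, ψ j (X i ω))))) ℙ ∧
    ∫ ω, ∏ j, (1 + r * (Real.exp (∑ i ∈ Finset.range n, ψ j (X i ω)) +
      Real.exp (-∑ i ∈ Finset.range n, ψ j (X i ω)))) ∂ℙ ≤
      Real.exp (6 * r * Fintype.card ι) := by
  classical
  set sgn : Fin 3 → ℝ := ![0, 1, -1] with hsgn
  set w : Fin 3 → ℝ := ![1, r, r] with hw
  have hw0 : ∀ s, 0 ≤ w s := by intro s; fin_cases s <;> simp [hw, hr]
  have hs1 : ∀ s, |sgn s| ≤ 1 := by intro s; fin_cases s <;> simp [hsgn]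
  have hexp : ∀ ω, ∏ j, (1 + r * (Real.exp (∑ i ∈ Finset.range n, ψ j (X i ω)) +
      Real.exp (-∑ i ∈ Finset.range n, ψ j (X i ω)))) =
      ∑ σ : ι → Fin 3, (∏ j, w (σ j)) *
        Real.exp (∑ j, sgn (σ j) * ∑ i ∈ Finset.range n, ψ j (X i ω)) := by
    intro ω
    have : ∀ x : ℝ, 1 + r * (Real.exp x + Real.exp (-x)) =
        ∑ s : Fin 3, w s * Real.exp (sgn s * x) := by
      intro x
      simp [Fin.sum_univ_three, hw, hsgn]
      ring
    simp only [this]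
    rw [Finset.prod_univ_sum, Fintype.piFinset_univ]
    refine Finset.sum_congr rfl fun σ _ => ?_
    rw [Finset.prod_mul_distrib, Real.exp_sum]
  simp only [hexp]
  have hkey := fun σ : ι → Fin 3 => integral_exp_signed_sum_le hXmeas hXlaw hXindep hψ hψ1 hdisj
    hmean hn hvar (s := fun j => sgn (σ j)) fun j => hs1 _
  refine ⟨integrable_finsetSum _ fun σ _ => (hkey σ).1.const_mul _, ?_⟩
  rw [integral_finsetSum _ fun σ _ => (hkey σ).1.const_mul _]
  calc ∑ σ : ι → Fin 3, ∫ ω, (∏ j, w (σ j)) *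
        Real.exp (∑ j, sgn (σ j) * ∑ i ∈ Finset.range n, ψ j (X i ω)) ∂ℙ
      ≤ ∑ σ : ι → Fin 3, ∏ j, (w (σ j) * Real.exp (sgn (σ j) ^ 2)) := by
        refine Finset.sum_le_sum fun σ _ => ?_
        rw [integral_const_mul, Finset.prod_mul_distrib, ← Real.exp_sum]
        exact mul_le_mul_of_nonneg_left (hkey σ).2 (Finset.prod_nonneg fun j _ => hw0 _)
    _ = ∏ _j : ι, ∑ s : Fin 3, w s * Real.exp (sgn s ^ 2) := by
        rw [Finset.prod_univ_sum, Fintype.piFinset_univ]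
    _ ≤ ∏ _j : ι, Real.exp (6 * r) := by
        refine Finset.prod_le_prod (fun j _ => Finset.sum_nonneg fun s _ =>
          mul_nonneg (hw0 s) (Real.exp_pos _).le) fun j _ => ?_
        have h1 : ∑ s : Fin 3, w s * Real.exp (sgn s ^ 2) = 2 * Real.exp 1 * r + 1 := by
          simp [Fin.sum_univ_three, hw, hsgn]
          ring
        rw [h1]
        refine le_trans ?_ (Real.add_one_le_exp _)
        have : Real.exp 1 ≤ 3 := by linarith [Real.exp_one_lt_d9]
        nlinarith
    _ = _ := by
        rw [Finset.prod_const, Finset.card_univ, ← Real.exp_nat_mul]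
        ring_nf

lemma measureReal_sum_log_ge_le (hXmeas : ∀ i, Measurable (X i))
    (hXlaw : ∀ i, Measure.map (X i) ℙ = μ)
    (hXindep : ProbabilityTheory.iIndepFun (m := fun _ => Real.measurableSpace) X ℙ)
    (hψ : ∀ j, Measurable (ψ j)) (hψ1 : ∀ j x, |ψ j x| ≤ 1)
    (hdisj : ∀ i j, i ≠ j → ∀ x, ψ i x * ψ j x = 0)
    (hmean : ∀ j, ∫ x, ψ j x ∂μ = 0) {n : ℕ} (hn : 0 < n)
    (hvar : ∀ j, ∫ x, ψ j x ^ 2 ∂μ ≤ 1 / n) {r : ℝ} (hr : 0 ≤ r) (u : ℝ) :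
    ℙ.real {ω | u ≤ ∑ j, Real.log (1 + r * Real.exp |∑ i ∈ Finset.range n, ψ j (X i ω)|)} ≤
      Real.exp (6 * r * Fintype.card ι - u) := by
  obtain ⟨h1, h2⟩ := integral_prod_one_add_exp_le hXmeas hXlaw hXindep hψ hψ1 hdisj
    hmean hn hvar hr
  have hpos : ∀ x : ℝ, 0 < 1 + r * (Real.exp x + Real.exp (-x)) := fun x => by positivity
  have h3 := mul_meas_ge_le_integral_of_nonneg
    (Filter.Eventually.of_forall fun ω => Finset.prod_nonneg fun j _ => (hpos _).le) h1
    (Real.exp u)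
  have hsub : {ω | u ≤ ∑ j, Real.log (1 + r * Real.exp |∑ i ∈ Finset.range n, ψ j (X i ω)|)} ⊆
      {ω | Real.exp u ≤ ∏ j, (1 + r * (Real.exp (∑ i ∈ Finset.range n, ψ j (X i ω)) +
      Real.exp (-∑ i ∈ Finset.range n, ψ j (X i ω))))} := by
    intro ω hω
    simp only [mem_ofPred_eq] at hω ⊢
    refine (Real.exp_le_exp.2 hω).trans ?_
    rw [Real.exp_sum]
    refine Finset.prod_le_prod (fun j _ => (Real.exp_pos _).le) fun j _ => ?_
    rw [Real.exp_log (by positivity)]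
    gcongr
    rcases abs_cases (∑ i ∈ Finset.range n, ψ j (X i ω)) with ⟨h, _⟩ | ⟨h, _⟩ <;> rw [h] <;>
      linarith [Real.exp_pos (∑ i ∈ Finset.range n, ψ j (X i ω)),
        Real.exp_pos (-∑ i ∈ Finset.range n, ψ j (X i ω))]
  refine (measureReal_mono hsub).trans ?_
  rw [Real.exp_sub, le_div_iff₀ (Real.exp_pos u), mul_comm]
  exact h3.trans h2

lemma measureReal_abs_sum_ge_le (hXmeas : ∀ i, Measurable (X i))
    (hXlaw : ∀ i, Measure.map (X i) ℙ = μ)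
    (hXindep : ProbabilityTheory.iIndepFun (m := fun _ => Real.measurableSpace) X ℙ)
    {g : ℝ → ℝ} (hg : Measurable g) (hg1 : ∀ x, |g x| ≤ 1)
    (hmean : ∫ x, g x ∂μ = 0) {n : ℕ} (hn : 0 < n)
    (hvar : ∫ x, g x ^ 2 ∂μ ≤ 1 / n) (u : ℝ) :
    ℙ.real {ω | u ≤ |∑ i ∈ Finset.range n, g (X i ω)|} ≤ Real.exp (7 - u) := by
  have h := measureReal_sum_log_ge_le (ι := Unit) (ψ := fun _ => g) hXmeas hXlaw hXindep
    (fun _ => hg) (fun _ => hg1) (fun i j hij => absurd (Subsingleton.elim i j) hij)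
    (fun _ => hmean) hn (fun _ => hvar) (r := 1) zero_le_one u
  refine (measureReal_mono fun ω hω => ?_).trans (h.trans (Real.exp_le_exp.2 ?_))
  · simp only [mem_ofPred_eq, Finset.univ_unique, Finset.sum_singleton, one_mul] at hω ⊢
    refine hω.trans ((Real.le_log_iff_exp_le (by positivity)).2 ?_)
    linarith
  · simp; norm_num

lemma measureReal_sum_ge_le (hXmeas : ∀ i, Measurable (X i))
    (hXlaw : ∀ i, Measure.map (X i) ℙ = μ)
    (hXindep : ProbabilityTheory.iIndepFun (m := fun _ => Real.measurableSpace) X ℙ)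
    {g : ℝ → ℝ} (hg : Measurable g) (hg1 : ∀ x, |g x| ≤ 1) (n : ℕ) (u : ℝ) :
    ℙ.real {ω | u ≤ ∑ i ∈ Finset.range n, g (X i ω)} ≤
      Real.exp (n * (∫ x, g x ∂μ + ∫ x, g x ^ 2 ∂μ) - u) := by
  have h3 := mul_meas_ge_le_integral_of_nonneg
    (Filter.Eventually.of_forall fun ω => (Real.exp_pos _).le)
    (integrable_exp_sum (ℙ := ℙ) hXmeas hg hg1 n) (Real.exp u)
  simp only [Real.exp_le_exp] at h3
  rw [Real.exp_sub, le_div_iff₀ (Real.exp_pos u), mul_comm]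
  exact h3.trans (integral_exp_sum_le hXmeas hXlaw hXindep hg hg1 n)

end ExponentialMoments

section DyadicCells

/-- `Q` is a quantile function of the diffuse measure `μ`. -/
structure IsQuantile (μ : Measure ℝ) (Q : ℝ → ℝ) : Prop where
  mono : MonotoneOn Q (Icc 0 1)
  measure_Ioc : ∀ u v, 0 ≤ u → u ≤ v → v ≤ 1 → μ.real (Ioc (Q u) (Q v)) = v - u

/-- The `j`-th dyadic quantile interval of generation `k`. -/
def cell (Q : ℝ → ℝ) (k j : ℕ) : Set ℝ := Ioc (Q (j / 2 ^ k)) (Q ((j + 1) / 2 ^ k))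

/-- The (unnormalised) Haar function of the dyadic quantile interval `cell Q k j`. -/
noncomputable def haar (Q : ℝ → ℝ) (k j : ℕ) (x : ℝ) : ℝ :=
  (cell Q (k + 1) (2 * j)).indicator 1 x - (cell Q (k + 1) (2 * j + 1)).indicator 1 x

variable {μ : Measure ℝ} {Q : ℝ → ℝ}

lemma measurableSet_cell (Q : ℝ → ℝ) (k j : ℕ) : MeasurableSet (cell Q k j) := measurableSet_Ioc

lemma measurable_haar (Q : ℝ → ℝ) (k j : ℕ) : Measurable (haar Q k j) :=
  ((measurable_one.indicator (measurableSet_cell _ _ _))).sub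
    (measurable_one.indicator (measurableSet_cell _ _ _))

lemma div_two_pow_mem {k j : ℕ} (hj : j ≤ 2 ^ k) : (j : ℝ) / 2 ^ k ∈ Icc (0 : ℝ) 1 := by
  refine ⟨by positivity, ?_⟩
  rw [div_le_one (by positivity)]
  exact_mod_cast hj

lemma succ_div_two_pow_mem {k j : ℕ} (hj : j < 2 ^ k) :
    ((j : ℝ) + 1) / 2 ^ k ∈ Icc (0 : ℝ) 1 := by
  exact_mod_cast div_two_pow_mem (k := k) (j := j + 1) hj

lemma IsQuantile.le_of_le (hQ : IsQuantile μ Q) {k i j : ℕ} (hij : i ≤ j) (hj : j ≤ 2 ^ k) :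
    Q (i / 2 ^ k) ≤ Q (j / 2 ^ k) := by
  refine hQ.mono (div_two_pow_mem (hij.trans hj)) (div_two_pow_mem hj) ?_
  gcongr

lemma IsQuantile.cell_eq_union (hQ : IsQuantile μ Q) {k j : ℕ} (hj : j < 2 ^ k) :
    cell Q k j = cell Q (k + 1) (2 * j) ∪ cell Q (k + 1) (2 * j + 1) := by
  have hle : 2 * j + 2 ≤ 2 ^ (k + 1) := by rw [pow_succ]; omega
  have h1 := hQ.le_of_le (show 2 * j ≤ 2 * j + 1 by omega) (show _ ≤ 2 ^ (k + 1) by omega)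
  have h2 := hQ.le_of_le (show 2 * j + 1 ≤ 2 * j + 2 by omega) hle
  have e1 : (j : ℝ) / 2 ^ k = ((2 * j : ℕ) : ℝ) / 2 ^ (k + 1) := by
    push_cast; rw [pow_succ]; field_simp
  have e2 : ((j : ℝ) + 1) / 2 ^ k = ((2 * j + 2 : ℕ) : ℝ) / 2 ^ (k + 1) := by
    push_cast; rw [pow_succ]; field_simp
  have e3 : (((2 * j + 1 : ℕ) : ℝ) + 1) = ((2 * j + 2 : ℕ) : ℝ) := by push_cast; ring
  have e4 : (((2 * j : ℕ) : ℝ) + 1) = ((2 * j + 1 : ℕ) : ℝ) := by push_cast; ring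
  unfold cell
  rw [e1, e2, e3, e4, Ioc_union_Ioc_eq_Ioc h1 h2]

lemma IsQuantile.disjoint_cell (hQ : IsQuantile μ Q) {k i j : ℕ} (hi : i < 2 ^ k) (hj : j < 2 ^ k)
    (hij : i ≠ j) : Disjoint (cell Q k i) (cell Q k j) := by
  wlog h : i < j generalizing i j
  · exact (this hj hi hij.symm (by omega)).symm
  rw [Set.disjoint_left]
  intro x hx hx'
  have h1 := hQ.le_of_le (show i + 1 ≤ j from h) hj.le
  push_cast at h1
  exact absurd (hx.2.trans h1) (not_le.2 hx'.1)

lemma IsQuantile.measure_cell (hQ : IsQuantile μ Q) {k j : ℕ} (hj : j < 2 ^ k) :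
    μ.real (cell Q k j) = 1 / 2 ^ k := by
  unfold cell
  rw [hQ.measure_Ioc _ _ (div_two_pow_mem hj.le).1 (by gcongr; linarith)
    (succ_div_two_pow_mem hj).2]
  ring

lemma IsQuantile.disjoint_children (hQ : IsQuantile μ Q) {k j : ℕ} (hj : j < 2 ^ k) :
    Disjoint (cell Q (k + 1) (2 * j)) (cell Q (k + 1) (2 * j + 1)) :=
  hQ.disjoint_cell (by rw [pow_succ]; omega) (by rw [pow_succ]; omega) (by omega)

lemma IsQuantile.indicator_cell (hQ : IsQuantile μ Q) {k j : ℕ} (hj : j < 2 ^ k) (x : ℝ) :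
    (cell Q k j).indicator (1 : ℝ → ℝ) x =
      (cell Q (k + 1) (2 * j)).indicator 1 x + (cell Q (k + 1) (2 * j + 1)).indicator 1 x := by
  rw [hQ.cell_eq_union hj, indicator_union_of_disjoint (hQ.disjoint_children hj)]

lemma IsQuantile.haar_sq (hQ : IsQuantile μ Q) {k j : ℕ} (hj : j < 2 ^ k) (x : ℝ) :
    haar Q k j x ^ 2 = (cell Q k j).indicator 1 x := by
  rw [hQ.indicator_cell hj, haar]
  have hd : x ∈ cell Q (k + 1) (2 * j) → x ∉ cell Q (k + 1) (2 * j + 1) := fun h =>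
    Set.disjoint_left.1 (hQ.disjoint_children hj) h
  by_cases h1 : x ∈ cell Q (k + 1) (2 * j)
  · simp [h1, hd h1]
  · by_cases h2 : x ∈ cell Q (k + 1) (2 * j + 1) <;> simp [h1, h2]

lemma IsQuantile.abs_haar_le (hQ : IsQuantile μ Q) {k j : ℕ} (hj : j < 2 ^ k) (x : ℝ) :
    |haar Q k j x| ≤ 1 := by
  rw [← sq_le_one_iff_abs_le_one, hQ.haar_sq hj]
  exact indicator_le_self' (fun _ _ => zero_le_one) x

lemma IsQuantile.haar_mul_haar (hQ : IsQuantile μ Q) {k i j : ℕ} (hi : i < 2 ^ k) (hj : j < 2 ^ k)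
    (hij : i ≠ j) (x : ℝ) : haar Q k i x * haar Q k j x = 0 := by
  rw [← sq_eq_zero_iff, mul_pow, hQ.haar_sq hi, hQ.haar_sq hj]
  have hd : x ∈ cell Q k i → x ∉ cell Q k j := fun h =>
    Set.disjoint_left.1 (hQ.disjoint_cell hi hj hij) h
  by_cases h1 : x ∈ cell Q k i
  · simp [hd h1]
  · simp [h1]

lemma IsQuantile.integral_haar (hQ : IsQuantile μ Q) [IsProbabilityMeasure μ] {k j : ℕ}
    (hj : j < 2 ^ k) :
    ∫ x, haar Q k j x ∂μ = 0 := by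
  have hi : ∀ i, Integrable ((cell Q (k + 1) i).indicator (1 : ℝ → ℝ)) μ := fun i =>
    (integrable_const (1 : ℝ)).indicator (measurableSet_cell _ _ _)
  unfold haar
  rw [integral_sub (hi _) (hi _), integral_indicator_one (measurableSet_cell _ _ _),
    integral_indicator_one (measurableSet_cell _ _ _),
    hQ.measure_cell (by rw [pow_succ]; omega), hQ.measure_cell (by rw [pow_succ]; omega), sub_self]

lemma IsQuantile.integral_haar_sq (hQ : IsQuantile μ Q) {k j : ℕ} (hj : j < 2 ^ k) :
    ∫ x, haar Q k j x ^ 2 ∂μ = 1 / 2 ^ k := by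
  simp only [hQ.haar_sq hj]
  rw [integral_indicator_one (measurableSet_cell _ _ _), hQ.measure_cell hj]

end DyadicCells

section HaarExpansion

/-- The average of `r` over a dyadic quantile interval. -/
noncomputable def cellAvg (μ : Measure ℝ) (Q r : ℝ → ℝ) (k j : ℕ) : ℝ :=
  2 ^ k * ∫ x in cell Q k j, r x ∂μ

/-- The coefficient of `haar Q k j` in the expansion of `r`. -/
noncomputable def haarCoeff (μ : Measure ℝ) (Q r : ℝ → ℝ) (k j : ℕ) : ℝ :=
  (cellAvg μ Q r (k + 1) (2 * j) - cellAvg μ Q r (k + 1) (2 * j + 1)) / 2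

variable {μ : Measure ℝ} {Q r : ℝ → ℝ}

lemma IsQuantile.cellAvg_eq (hQ : IsQuantile μ Q) (hr : Integrable r μ) {k j : ℕ}
    (hj : j < 2 ^ k) : cellAvg μ Q r k j =
      (cellAvg μ Q r (k + 1) (2 * j) + cellAvg μ Q r (k + 1) (2 * j + 1)) / 2 := by
  unfold cellAvg
  rw [hQ.cell_eq_union hj, setIntegral_union (hQ.disjoint_children hj) (measurableSet_cell _ _ _)
    hr.integrableOn hr.integrableOn]
  ring

lemma sum_range_two_mul {M : Type*} [AddCommMonoid M] (f : ℕ → M) (m : ℕ) :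
    ∑ i ∈ Finset.range (2 * m), f i = ∑ i ∈ Finset.range m, (f (2 * i) + f (2 * i + 1)) := by
  induction m with
  | zero => simp
  | succ m ih =>
    rw [show 2 * (m + 1) = 2 * m + 1 + 1 by ring, Finset.sum_range_succ, Finset.sum_range_succ,
      Finset.sum_range_succ, ih, add_assoc]

lemma IsQuantile.sum_cellAvg_indicator (hQ : IsQuantile μ Q) (hr : Integrable r μ) (K : ℕ)
    (x : ℝ) :
    ∑ j ∈ Finset.range (2 ^ K), cellAvg μ Q r K j * (cell Q K j).indicator 1 x =
      cellAvg μ Q r 0 0 * (cell Q 0 0).indicator 1 x +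
        ∑ k ∈ Finset.range K, ∑ j ∈ Finset.range (2 ^ k), haarCoeff μ Q r k j * haar Q k j x := by
  induction K with
  | zero => simp
  | succ K ih =>
    rw [Finset.sum_range_succ, ← add_assoc, ← ih, pow_succ', sum_range_two_mul,
      ← Finset.sum_add_distrib]
    refine Finset.sum_congr rfl fun j hj => ?_
    have hj := Finset.mem_range.1 hj
    rw [hQ.cellAvg_eq hr hj, hQ.indicator_cell hj, haarCoeff, haar]
    ring

lemma IsQuantile.exists_mem_cell (hQ : IsQuantile μ Q) {x : ℝ} (hx : x ∈ Ioc (Q 0) (Q 1)) (k : ℕ) :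
    ∃ j < 2 ^ k, x ∈ cell Q k j := by
  induction k with
  | zero => exact ⟨0, by simp, by simpa [cell] using hx⟩
  | succ k ih =>
    obtain ⟨j, hj, hxj⟩ := ih
    rw [hQ.cell_eq_union hj] at hxj
    rcases hxj with h | h
    · exact ⟨2 * j, by rw [pow_succ]; omega, h⟩
    · exact ⟨2 * j + 1, by rw [pow_succ]; omega, h⟩

lemma IsQuantile.sum_indicator_of_mem (hQ : IsQuantile μ Q) {k j : ℕ} (hj : j < 2 ^ k) {x : ℝ}
    (hx : x ∈ cell Q k j) (c : ℕ → ℝ) :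
    ∑ i ∈ Finset.range (2 ^ k), c i * (cell Q k i).indicator 1 x = c j := by
  rw [Finset.sum_eq_single j]
  · simp [hx]
  · intro i hi hij
    have := Set.disjoint_right.1 (hQ.disjoint_cell (Finset.mem_range.1 hi) hj hij) hx
    simp [this]
  · simp [hj]

lemma IsQuantile.abs_sub_cellAvg_le (hQ : IsQuantile μ Q) [IsProbabilityMeasure μ]
    (hr : Integrable r μ) {k j : ℕ} (hj : j < 2 ^ k) {y V : ℝ}
    (hV : ∀ x ∈ cell Q k j, |r x - y| ≤ V) : |cellAvg μ Q r k j - y| ≤ V := by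
  have hm := hQ.measure_cell hj
  have h1 : cellAvg μ Q r k j - y = 2 ^ k * ∫ x in cell Q k j, (r x - y) ∂μ := by
    rw [integral_sub hr.integrableOn (integrable_const _), setIntegral_const, hm, cellAvg]
    simp
    field_simp
  have h2 := norm_setIntegral_le_of_norm_le_const (μ := μ) (s := cell Q k j)
    (measure_lt_top _ _) (f := fun x => r x - y) (C := V) hV
  rw [hm] at h2
  rw [h1, abs_mul, abs_of_pos (by positivity)]
  calc (2 : ℝ) ^ k * |∫ x in cell Q k j, (r x - y) ∂μ| ≤ 2 ^ k * (V * (1 / 2 ^ k)) := by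
        gcongr
        exact h2
    _ = V := by field_simp

lemma IsQuantile.abs_haarCoeff_le (hQ : IsQuantile μ Q) [IsProbabilityMeasure μ]
    (hr : Integrable r μ) {k j : ℕ} (hj : j < 2 ^ k) {V : ℝ}
    (hV : ∀ x ∈ cell Q k j, ∀ y ∈ cell Q k j, |r x - r y| ≤ V) (hV0 : 0 ≤ V) :
    |haarCoeff μ Q r k j| ≤ V := by
  have hsub := hQ.cell_eq_union hj
  have h1 : 2 * j < 2 ^ (k + 1) := by rw [pow_succ]; omega
  have h2 : 2 * j + 1 < 2 ^ (k + 1) := by rw [pow_succ]; omega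
  have key : |cellAvg μ Q r (k + 1) (2 * j) - cellAvg μ Q r (k + 1) (2 * j + 1)| ≤ V := by
    refine hQ.abs_sub_cellAvg_le hr h1 fun x hx => ?_
    rw [abs_sub_comm]
    refine hQ.abs_sub_cellAvg_le hr h2 fun y hy => ?_
    exact hV y (hsub ▸ Or.inr hy) x (hsub ▸ Or.inl hx)
  rw [haarCoeff, abs_div, abs_two]
  linarith [abs_nonneg (cellAvg μ Q r (k + 1) (2 * j) - cellAvg μ Q r (k + 1) (2 * j + 1))]

lemma sq_setIntegral_le [IsProbabilityMeasure μ] (hr : Integrable r μ)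
    (hr2 : Integrable (fun x => r x ^ 2) μ) {s : Set ℝ} :
    (∫ x in s, r x ∂μ) ^ 2 ≤ μ.real s * ∫ x in s, r x ^ 2 ∂μ := by
  set I := ∫ x in s, r x ∂μ
  have h : ∀ t : ℝ, 0 ≤ μ.real s * (t * t) + (-2 * I) * t + ∫ x in s, r x ^ 2 ∂μ := by
    intro t
    have h0 : 0 ≤ ∫ x in s, (r x - t) ^ 2 ∂μ := integral_nonneg fun x => sq_nonneg _
    have h1 : ∫ x in s, (r x - t) ^ 2 ∂μ
        = μ.real s * (t * t) + (-2 * I) * t + ∫ x in s, r x ^ 2 ∂μ := by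
      have : ∀ x, (r x - t) ^ 2 = (r x ^ 2 - 2 * t * r x) + t ^ 2 := fun x => by ring
      simp only [this]
      rw [integral_add (f := fun x => r x ^ 2 - 2 * t * r x)
        (hr2.restrict.sub (hr.restrict.const_mul _)) (integrable_const _),
        integral_sub hr2.restrict (hr.restrict.const_mul _), integral_const_mul,
        setIntegral_const]
      simp only [smul_eq_mul]
      ring
    linarith
  have := discrim_le_zero h
  rw [discrim] at this
  nlinarith

lemma IsQuantile.haarCoeff_sq_le (hQ : IsQuantile μ Q) [IsProbabilityMeasure μ]
    (hr : Integrable r μ) (hr2 : Integrable (fun x => r x ^ 2) μ) {k j : ℕ} (hj : j < 2 ^ k) :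
    haarCoeff μ Q r k j ^ 2 ≤ 2 ^ k * ∫ x in cell Q k j, r x ^ 2 ∂μ := by
  have h1 : 2 * j < 2 ^ (k + 1) := by rw [pow_succ]; omega
  have h2 : 2 * j + 1 < 2 ^ (k + 1) := by rw [pow_succ]; omega
  have a1 := sq_setIntegral_le hr hr2 (s := cell Q (k + 1) (2 * j))
  have a2 := sq_setIntegral_le hr hr2 (s := cell Q (k + 1) (2 * j + 1))
  rw [hQ.measure_cell h1] at a1
  rw [hQ.measure_cell h2] at a2
  rw [hQ.cell_eq_union hj, setIntegral_union (hQ.disjoint_children hj) (measurableSet_cell _ _ _)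
    hr2.integrableOn hr2.integrableOn, haarCoeff, cellAvg, cellAvg]
  set A := ∫ x in cell Q (k + 1) (2 * j), r x ∂μ
  set B := ∫ x in cell Q (k + 1) (2 * j + 1), r x ∂μ
  set A' := ∫ x in cell Q (k + 1) (2 * j), r x ^ 2 ∂μ
  set B' := ∫ x in cell Q (k + 1) (2 * j + 1), r x ^ 2 ∂μ
  set p : ℝ := 2 ^ k with hp
  have hp0 : 0 < p := by positivity
  have hp1 : (2 : ℝ) ^ (k + 1) = 2 * p := by rw [pow_succ]; ring
  rw [hp1] at a1 a2 ⊢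
  rw [one_div_mul_eq_div, le_div_iff₀ (by positivity)] at a1 a2
  have e : ((2 * p * A - 2 * p * B) / 2) ^ 2 = p ^ 2 * (A - B) ^ 2 := by ring
  rw [e]
  nlinarith [mul_le_mul_of_nonneg_left a1 hp0.le, mul_le_mul_of_nonneg_left a2 hp0.le,
    mul_nonneg (sq_nonneg p) (sq_nonneg (A + B))]

lemma IsQuantile.sum_haarCoeff_sq_le (hQ : IsQuantile μ Q) [IsProbabilityMeasure μ]
    (hr : Integrable r μ) (hr2 : Integrable (fun x => r x ^ 2) μ) (k : ℕ) :
    ∑ j ∈ Finset.range (2 ^ k), haarCoeff μ Q r k j ^ 2 ≤ 2 ^ k * ∫ x, r x ^ 2 ∂μ := by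
  calc _ ≤ ∑ j ∈ Finset.range (2 ^ k), 2 ^ k * ∫ x in cell Q k j, r x ^ 2 ∂μ :=
        Finset.sum_le_sum fun j hj => hQ.haarCoeff_sq_le hr hr2 (Finset.mem_range.1 hj)
    _ = 2 ^ k * ∫ x in ⋃ j ∈ Finset.range (2 ^ k), cell Q k j, r x ^ 2 ∂μ := by
        rw [← Finset.mul_sum, integral_biUnion_finset _ (fun j _ => measurableSet_cell _ _ _)
          (fun i hi j hj hij => hQ.disjoint_cell (Finset.mem_range.1 hi) (Finset.mem_range.1 hj) hij)
          (fun j _ => hr2.integrableOn)]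
    _ ≤ _ := by
        gcongr
        · exact Filter.Eventually.of_forall fun x => sq_nonneg _
        · exact Measure.restrict_le_self

end HaarExpansion

section GoodSamples

/-- The empirical Haar coefficients of the sample `x 0, …, x (n-1)`, normalised to unit
variance. -/
noncomputable def empHaar (Q : ℝ → ℝ) (x : ℕ → ℝ) (n k j : ℕ) : ℝ :=
  √2 ^ k / √n * ∑ i ∈ Finset.range n, haar Q k j (x i)

/-- A sample whose empirical Haar coefficients have eighth moments of order `T ^ 8` at all
generations up to `log₂ n`, and whose points do not cluster in the smallest cells. -/
structure IsGoodSample (C : ℝ) (Q : ℝ → ℝ) (x : ℕ → ℝ) (n : ℕ) (T : ℝ) : Prop where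
  sum_pow_eight_le : ∀ k < Nat.log 2 n,
    ∑ j ∈ Finset.range (2 ^ k), |empHaar Q x n k j| ^ 8 ≤ C * T ^ 8 * 2 ^ k
  count_le : ∀ j < 2 ^ Nat.log 2 n,
    ∑ i ∈ Finset.range n, (cell Q (Nat.log 2 n) j).indicator 1 (x i) ≤
      T * ((Nat.log 2 n : ℝ) + 1)
  mem : ∀ i, x i ∈ Ioc (Q 0) (Q 1)

lemma sqrt_two_pow_sq (k : ℕ) : (√2 ^ k) ^ 2 = (2 : ℝ) ^ k := by
  rw [← pow_mul, mul_comm, pow_mul, Real.sq_sqrt (by norm_num)]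

lemma cast_le_three_mul_sqrt_two_pow (k : ℕ) : (k : ℝ) ≤ 3 * √2 ^ k := by
  have h0 : (1.4 : ℝ) ≤ √2 := Real.le_sqrt_of_sq_le (by norm_num)
  have h := one_add_mul_le_pow (a := (0.4 : ℝ)) (by norm_num) k
  have h2 : (1 + 0.4 : ℝ) ^ k ≤ √2 ^ k := by
    gcongr
    linarith
  have := Nat.cast_nonneg (α := ℝ) k
  linarith

variable {Ω : Type*} [MeasurableSpace Ω] {ℙ : Measure Ω} [IsProbabilityMeasure ℙ]
  {μ : Measure ℝ} {X : ℕ → Ω → ℝ} {Q : ℝ → ℝ}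

lemma measureReal_sum_log_empHaar_ge_le (hXmeas : ∀ i, Measurable (X i))
    (hXlaw : ∀ i, Measure.map (X i) ℙ = μ)
    (hXindep : ProbabilityTheory.iIndepFun (m := fun _ => Real.measurableSpace) X ℙ)
    (hQ : IsQuantile μ Q) {n k : ℕ} (hn : 0 < n) (hk : 2 ^ k ≤ n) (T : ℝ) :
    ℙ.real {ω | 6 * √2 ^ k + T + k ≤ ∑ j ∈ Finset.range (2 ^ k),
        Real.log (1 + Real.exp |empHaar Q (fun i => X i ω) n k j| / √2 ^ k)} ≤
      Real.exp (-T) * (1 / 2) ^ k ∧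
    ∀ j < 2 ^ k, ℙ.real {ω | T * (k + 1) ≤ |empHaar Q (fun i => X i ω) n k j|} ≤
      Real.exp (7 - T * (k + 1)) := by
  have : IsProbabilityMeasure μ := isProbabilityMeasure_of_map_eq hXmeas hXlaw
  have hn' : (0 : ℝ) < n := by exact_mod_cast hn
  set θ : ℝ := √2 ^ k / √n with hθ
  have hθ0 : 0 ≤ θ := by positivity
  have hθ2 : θ ^ 2 = 2 ^ k / n := by
    rw [hθ, div_pow, sqrt_two_pow_sq, Real.sq_sqrt hn'.le]
  have hθ1 : θ ≤ 1 := by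
    rw [← sq_le_one_iff₀ hθ0, hθ2, div_le_one hn']
    exact_mod_cast hk
  have hmeas : ∀ j, Measurable fun x => θ * haar Q k j x := fun j =>
    (measurable_haar Q k j).const_mul θ
  have habs : ∀ j < 2 ^ k, ∀ x, |θ * haar Q k j x| ≤ 1 := fun j hj x => by
    rw [abs_mul, abs_of_nonneg hθ0]
    exact mul_le_one₀ hθ1 (abs_nonneg _) (hQ.abs_haar_le hj x)
  have hmean : ∀ j < 2 ^ k, ∫ x, θ * haar Q k j x ∂μ = 0 := fun j hj => by
    rw [integral_const_mul, hQ.integral_haar hj, mul_zero]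
  have hvar : ∀ j < 2 ^ k, ∫ x, (θ * haar Q k j x) ^ 2 ∂μ ≤ 1 / n := fun j hj => by
    simp only [mul_pow]
    rw [integral_const_mul, hQ.integral_haar_sq hj, hθ2]
    apply le_of_eq
    field_simp
  have hemp : ∀ ω j, empHaar Q (fun i => X i ω) n k j =
      ∑ i ∈ Finset.range n, θ * haar Q k j (X i ω) := fun ω j => by
    rw [empHaar, Finset.mul_sum]
  simp only [hemp]
  refine ⟨?_, fun j hj => measureReal_abs_sum_ge_le hXmeas hXlaw hXindep (hmeas j) (habs j hj)
    (hmean j hj) hn (hvar j hj) _⟩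
  have h := measureReal_sum_log_ge_le (ι := Fin (2 ^ k)) (ψ := fun j x => θ * haar Q k j x)
    hXmeas hXlaw hXindep (fun j => hmeas j) (fun j => habs j j.2)
    (fun i j hij x => by
      rw [mul_mul_mul_comm, hQ.haar_mul_haar i.2 j.2 (fun h => hij (Fin.ext h)), mul_zero])
    (fun j => hmean j j.2) hn (fun j => hvar j j.2) (r := (√2 ^ k)⁻¹) (by positivity)
    (6 * √2 ^ k + T + k)
  have e : ∀ ω, ∑ j ∈ Finset.range (2 ^ k),
      Real.log (1 + Real.exp |∑ i ∈ Finset.range n, θ * haar Q k j (X i ω)| / √2 ^ k) =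
      ∑ j : Fin (2 ^ k), Real.log (1 + (√2 ^ k)⁻¹ *
        Real.exp |∑ i ∈ Finset.range n, θ * haar Q k j (X i ω)|) := fun ω => by
    rw [Finset.sum_range]
    simp only [div_eq_inv_mul]
  simp only [e]
  refine h.trans ?_
  have e2 : 6 * (√2 ^ k)⁻¹ * (Fintype.card (Fin (2 ^ k)) : ℝ) = 6 * √2 ^ k := by
    rw [Fintype.card_fin]
    push_cast
    rw [← sqrt_two_pow_sq]
    have : (0 : ℝ) < √2 ^ k := by positivity
    field_simp
  rw [e2, show 6 * √2 ^ k - (6 * √2 ^ k + T + k) = -T + k * (-1) by ring, Real.exp_add,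
    Real.exp_nat_mul]
  gcongr
  rw [Real.exp_neg, one_div]
  apply inv_anti₀ (by norm_num)
  linarith [Real.add_one_le_exp (1 : ℝ)]

lemma measureReal_count_ge_le (hXmeas : ∀ i, Measurable (X i))
    (hXlaw : ∀ i, Measure.map (X i) ℙ = μ)
    (hXindep : ProbabilityTheory.iIndepFun (m := fun _ => Real.measurableSpace) X ℙ)
    (hQ : IsQuantile μ Q) {n k j : ℕ} (hk : n ≤ 2 ^ (k + 1)) (hj : j < 2 ^ k) (T : ℝ) :
    ℙ.real {ω | T * (k + 1) ≤ ∑ i ∈ Finset.range n, (cell Q k j).indicator 1 (X i ω)} ≤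
      Real.exp (4 - T * (k + 1)) := by
  have : IsProbabilityMeasure μ := isProbabilityMeasure_of_map_eq hXmeas hXlaw
  have hsq : ∀ x, (cell Q k j).indicator (1 : ℝ → ℝ) x ^ 2 = (cell Q k j).indicator 1 x := by
    intro x
    by_cases hx : x ∈ cell Q k j <;> simp [hx]
  have h := measureReal_sum_ge_le hXmeas hXlaw hXindep
    (g := (cell Q k j).indicator 1) (measurable_one.indicator (measurableSet_cell _ _ _))
    (fun x => by by_cases hx : x ∈ cell Q k j <;> simp [hx]) n (T * (k + 1))
  refine h.trans (Real.exp_le_exp.2 ?_)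
  simp only [hsq]
  rw [integral_indicator_one (measurableSet_cell _ _ _), hQ.measure_cell hj]
  have hk' : (n : ℝ) ≤ 2 ^ (k + 1) := by exact_mod_cast hk
  have : (n : ℝ) * (1 / 2 ^ k + 1 / 2 ^ k) ≤ 2 ^ (k + 1) * (1 / 2 ^ k + 1 / 2 ^ k) := by gcongr
  have e : (2 : ℝ) ^ (k + 1) * (1 / 2 ^ k + 1 / 2 ^ k) = 4 := by
    rw [pow_succ]; field_simp; norm_num
  linarith

lemma IsQuantile.measure_compl_eq_zero [IsProbabilityMeasure μ] (hQ : IsQuantile μ Q) :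
    μ (Ioc (Q 0) (Q 1))ᶜ = 0 := by
  rw [prob_compl_eq_zero_iff measurableSet_Ioc]
  have h := hQ.measure_Ioc 0 1 le_rfl zero_le_one le_rfl
  rw [sub_zero] at h
  exact (ENNReal.toReal_eq_one_iff _).1 h

lemma measureReal_exists_notMem_eq_zero (hXmeas : ∀ i, Measurable (X i))
    (hXlaw : ∀ i, Measure.map (X i) ℙ = μ) (hQ : IsQuantile μ Q) :
    ℙ.real {ω | ∃ i, X i ω ∉ Ioc (Q 0) (Q 1)} = 0 := by
  have : IsProbabilityMeasure μ := isProbabilityMeasure_of_map_eq hXmeas hXlaw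
  have h : ∀ i, ℙ {ω | X i ω ∉ Ioc (Q 0) (Q 1)} = 0 := by
    intro i
    have h1 := hQ.measure_compl_eq_zero
    rw [← hXlaw i, Measure.map_apply (hXmeas i) measurableSet_Ioc.compl] at h1
    exact h1
  rw [measureReal_def, show {ω | ∃ i, X i ω ∉ Ioc (Q 0) (Q 1)} =
    ⋃ i, {ω | X i ω ∉ Ioc (Q 0) (Q 1)} by ext; simp, measure_iUnion_null h]
  rfl

lemma sum_half_pow_le (K : ℕ) : ∑ k ∈ Finset.range K, (1 / 2 : ℝ) ^ k ≤ 2 := by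
  have h : ∑ k ∈ Finset.range K, (1 / 2 : ℝ) ^ k = 2 - 2 * (1 / 2) ^ K := by
    rw [geom_sum_eq (by norm_num)]
    ring
  have : (0 : ℝ) < (1 / 2) ^ K := by positivity
  linarith

lemma two_pow_mul_exp_le {T : ℝ} (hT : 2 ≤ T) (c : ℝ) (k : ℕ) :
    2 ^ k * Real.exp (c - T * (k + 1)) ≤ Real.exp c * Real.exp (-T) * (1 / 2) ^ k := by
  have h1 : Real.exp (c - T * (k + 1)) = Real.exp c * Real.exp (-T) * Real.exp (-T) ^ k := by
    rw [← Real.exp_nat_mul, ← Real.exp_add, ← Real.exp_add]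
    ring_nf
  have h2 : 2 * Real.exp (-T) ≤ 1 / 2 := by
    have h3 : Real.exp (-T) ≤ Real.exp (-2) := Real.exp_le_exp.2 (by linarith)
    have h4 : Real.exp (-2) ≤ 1 / 4 := by
      rw [Real.exp_neg, one_div]
      apply inv_anti₀ (by norm_num)
      rw [show (2 : ℝ) = 1 + 1 by norm_num, Real.exp_add]
      nlinarith [Real.add_one_le_exp (1 : ℝ)]
    linarith
  rw [h1]
  calc _ = Real.exp c * Real.exp (-T) * (2 * Real.exp (-T)) ^ k := by rw [mul_pow]; ring
    _ ≤ _ := by gcongr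

/-- All but exponentially few samples are good. -/
lemma exists_measureReal_not_isGoodSample_le : ∃ C > (0 : ℝ), ∃ B > (0 : ℝ),
    ∀ {Ω : Type*} [MeasurableSpace Ω] {ℙ : Measure Ω} [IsProbabilityMeasure ℙ]
      {μ : Measure ℝ} {X : ℕ → Ω → ℝ} {Q : ℝ → ℝ} (_ : ∀ i, Measurable (X i))
      (_ : ∀ i, Measure.map (X i) ℙ = μ)
      (_ : ProbabilityTheory.iIndepFun (m := fun _ => Real.measurableSpace) X ℙ)
      (_ : IsQuantile μ Q) {n : ℕ} (_ : 0 < n) {T : ℝ} (_ : 2 ≤ T),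
    ℙ.real {ω | ¬ IsGoodSample C Q (fun i => X i ω) n T} ≤ B * Real.exp (-T) := by
  obtain ⟨C, hC, hpt⟩ := exists_pow_eight_le_log
  refine ⟨10 * C, by positivity, 2 + 2 * Real.exp 7 + Real.exp 4, by positivity, ?_⟩
  intro Ω _ ℙ _ μ X Q hXmeas hXlaw hXindep hQ n hn T hT
  set K := Nat.log 2 n with hK
  set E₁ : ℕ → Set Ω := fun k => {ω | 6 * √2 ^ k + T + k ≤ ∑ j ∈ Finset.range (2 ^ k),
        Real.log (1 + Real.exp |empHaar Q (fun i => X i ω) n k j| / √2 ^ k)}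
  set E₂ : ℕ → ℕ → Set Ω := fun k j => {ω | T * (k + 1) ≤ |empHaar Q (fun i => X i ω) n k j|}
  set E₃ : ℕ → Set Ω := fun j => {ω | T * (K + 1) ≤
    ∑ i ∈ Finset.range n, (cell Q K j).indicator 1 (X i ω)}
  set E₄ : Set Ω := {ω | ∃ i, X i ω ∉ Ioc (Q 0) (Q 1)}
  have hsub : {ω | ¬ IsGoodSample (10 * C) Q (fun i => X i ω) n T} ⊆
      (((⋃ k ∈ Finset.range K, E₁ k) ∪ (⋃ k ∈ Finset.range K, ⋃ j ∈ Finset.range (2 ^ k), E₂ k j))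
        ∪ (⋃ j ∈ Finset.range (2 ^ K), E₃ j)) ∪ E₄ := by
    intro ω hω
    by_contra hcon
    apply hω
    simp only [mem_union, mem_iUnion, Finset.mem_range, not_or, not_exists] at hcon
    obtain ⟨⟨⟨h1, h2⟩, h3⟩, h4⟩ := hcon
    refine ⟨fun k hk => ?_, fun j hj => (lt_of_not_ge (h3 j hj)).le, fun i => ?_⟩
    · have h1k : ∑ j ∈ Finset.range (2 ^ k),
          Real.log (1 + Real.exp |empHaar Q (fun i => X i ω) n k j| / √2 ^ k) <
          6 * √2 ^ k + T + k := lt_of_not_ge (h1 k hk)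
      have hb : (1 : ℝ) ≤ √2 ^ k := one_le_pow₀ (Real.one_le_sqrt.2 (by norm_num))
      have hT1 : 1 ≤ T := by linarith
      calc ∑ j ∈ Finset.range (2 ^ k), |empHaar Q (fun i => X i ω) n k j| ^ 8
          ≤ ∑ j ∈ Finset.range (2 ^ k), C * √2 ^ k * T ^ 7 *
            Real.log (1 + Real.exp |empHaar Q (fun i => X i ω) n k j| / √2 ^ k) := by
            refine Finset.sum_le_sum fun j hj => ?_
            exact hpt k T _ hT1 (abs_nonneg _) (lt_of_not_ge
              (h2 k hk j (Finset.mem_range.1 hj))).le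
        _ ≤ C * √2 ^ k * T ^ 7 * (6 * √2 ^ k + T + k) := by
            rw [← Finset.mul_sum]
            gcongr
        _ ≤ C * √2 ^ k * T ^ 7 * (10 * T * √2 ^ k) := by
            gcongr
            have := cast_le_three_mul_sqrt_two_pow k
            nlinarith
        _ = 10 * C * T ^ 8 * (√2 ^ k) ^ 2 := by ring
        _ = _ := by rw [sqrt_two_pow_sq]
    · by_contra hi
      exact h4 ⟨i, hi⟩
  have hK1 : ∀ k, k < K → 2 ^ k ≤ n := fun k hk =>
    (Nat.pow_le_pow_right (by norm_num) hk.le).trans (Nat.pow_log_le_self 2 hn.ne')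
  have b1 : ℙ.real (⋃ k ∈ Finset.range K, E₁ k) ≤ 2 * Real.exp (-T) := by
    refine (measureReal_biUnion_finset_le _ _).trans ?_
    calc _ ≤ ∑ k ∈ Finset.range K, Real.exp (-T) * (1 / 2) ^ k :=
          Finset.sum_le_sum fun k hk => (measureReal_sum_log_empHaar_ge_le hXmeas hXlaw hXindep hQ
            hn (hK1 k (Finset.mem_range.1 hk)) T).1
      _ ≤ Real.exp (-T) * 2 := by
          rw [← Finset.mul_sum]
          gcongr
          exact sum_half_pow_le K
      _ = _ := mul_comm _ _
  have b2 : ℙ.real (⋃ k ∈ Finset.range K, ⋃ j ∈ Finset.range (2 ^ k), E₂ k j) ≤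
      2 * Real.exp 7 * Real.exp (-T) := by
    refine (measureReal_biUnion_finset_le _ _).trans ?_
    calc _ ≤ ∑ k ∈ Finset.range K, Real.exp 7 * Real.exp (-T) * (1 / 2) ^ k := by
          refine Finset.sum_le_sum fun k hk => (measureReal_biUnion_finset_le _ _).trans ?_
          refine le_trans (Finset.sum_le_sum fun j hj =>
            (measureReal_sum_log_empHaar_ge_le hXmeas hXlaw hXindep hQ
            hn (hK1 k (Finset.mem_range.1 hk)) T).2 j (Finset.mem_range.1 hj)) ?_
          rw [Finset.sum_const, Finset.card_range, nsmul_eq_mul]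
          push_cast
          exact two_pow_mul_exp_le hT 7 k
      _ ≤ Real.exp 7 * Real.exp (-T) * 2 := by
          rw [← Finset.mul_sum]
          gcongr
          exact sum_half_pow_le K
      _ = _ := by ring
  have b3 : ℙ.real (⋃ j ∈ Finset.range (2 ^ K), E₃ j) ≤ Real.exp 4 * Real.exp (-T) := by
    refine (measureReal_biUnion_finset_le _ _).trans ?_
    refine le_trans (Finset.sum_le_sum fun j hj => measureReal_count_ge_le hXmeas hXlaw hXindep hQ
      (Nat.lt_pow_succ_log_self (by norm_num) n).le (Finset.mem_range.1 hj) T) ?_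
    rw [Finset.sum_const, Finset.card_range, nsmul_eq_mul]
    push_cast
    refine (two_pow_mul_exp_le hT 4 K).trans (mul_le_of_le_one_right (by positivity) ?_)
    exact pow_le_one₀ (by norm_num) (by norm_num)
  have b4 : ℙ.real E₄ = 0 := measureReal_exists_notMem_eq_zero hXmeas hXlaw hQ
  have u1 := measureReal_union_le (μ := ℙ) (⋃ k ∈ Finset.range K, E₁ k)
    (⋃ k ∈ Finset.range K, ⋃ j ∈ Finset.range (2 ^ k), E₂ k j)
  have u2 := measureReal_union_le (μ := ℙ) ((⋃ k ∈ Finset.range K, E₁ k) ∪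
    (⋃ k ∈ Finset.range K, ⋃ j ∈ Finset.range (2 ^ k), E₂ k j)) (⋃ j ∈ Finset.range (2 ^ K), E₃ j)
  have u3 := measureReal_union_le (μ := ℙ) (((⋃ k ∈ Finset.range K, E₁ k) ∪
    (⋃ k ∈ Finset.range K, ⋃ j ∈ Finset.range (2 ^ k), E₂ k j)) ∪
    (⋃ j ∈ Finset.range (2 ^ K), E₃ j)) E₄
  refine (measureReal_mono hsub).trans ?_
  linarith

end GoodSamples

section Chaining

lemma sum_mul_le_min {ι : Type*} (t : Finset ι) (c α : ι → ℝ) {C T q s y : ℝ} (hT : 0 < T)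
    (hC : 0 ≤ C) (hq : 0 < q) (hs : 0 < s) (hy : 0 < y) (hyq : y ^ 2 = q * s)
    (hcard : (t.card : ℝ) = s ^ 2) (hc : ∀ i ∈ t, 0 ≤ c i) (hα : ∀ i ∈ t, 0 ≤ α i)
    (hA : ∑ i ∈ t, c i ≤ 1 / s) (hD : ∑ i ∈ t, c i ^ 2 ≤ (3 * q ^ 2) ^ 2)
    (hM : ∑ i ∈ t, α i ^ 8 ≤ C * T ^ 8 * s ^ 2) :
    ∑ i ∈ t, c i * α i ≤ 3 * (1 + √C) * T * q * min y y⁻¹ := by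
  have hM' : ∑ i ∈ t, α i ^ 8 ≤ (√C * T ^ 4 * s) ^ 2 := by
    rw [mul_pow, mul_pow, Real.sq_sqrt hC]
    exact hM.trans_eq (by ring)
  have hsC := Real.sqrt_nonneg C
  have hs' : s = y ^ 2 / q := by rw [hyq]; field_simp
  rcases le_total 1 y with h | h
  · rw [min_eq_right ((inv_le_one_of_one_le₀ h).trans h)]
    refine (sum_mul_le_of_pow_eight t c α (l := T * y) (by positivity) hc hα hA (by positivity)
      (by positivity) hD hM').trans ?_
    have e : T * y * (1 / s) + 3 * q ^ 2 * (√C * T ^ 4 * s) / (T * y) ^ 3 =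
        (1 + 3 * √C) * T * q * y⁻¹ := by
      rw [hs']; field_simp
    rw [e]
    gcongr
    linarith
  · rw [min_eq_left (h.trans ((one_le_inv₀ hy).2 h))]
    have hA' : ∑ i ∈ t, c i ≤ 3 * q ^ 2 * s := by
      refine le_of_sq_le_sq ?_ (by positivity)
      have h1 := sq_sum_le_card_mul_sum_sq (s := t) (f := c)
      rw [hcard] at h1
      calc _ ≤ s ^ 2 * ∑ i ∈ t, c i ^ 2 := h1
        _ ≤ s ^ 2 * (3 * q ^ 2) ^ 2 := by gcongr
        _ = _ := by ring
    refine (sum_mul_le_of_pow_eight t c α (l := T) hT hc hα hA' (by positivity)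
      (by positivity) hD hM').trans ?_
    have e : T * (3 * q ^ 2 * s) + 3 * q ^ 2 * (√C * T ^ 4 * s) / T ^ 3 =
        3 * (1 + √C) * T * q * y ^ 2 := by
      rw [hs']; field_simp
    rw [e]
    gcongr
    nlinarith

variable {μ : Measure ℝ} {Q r : ℝ → ℝ} {x : ℕ → ℝ} {C T δ : ℝ} {n : ℕ}

/-- The contribution of one generation of Haar functions to the empirical process. -/
lemma IsGoodSample.sum_haarCoeff_mul_le [IsProbabilityMeasure μ] (hx : IsGoodSample C Q x n T)
    (hQ : IsQuantile μ Q) (hC : 0 ≤ C) (hT : 0 < T) (hδ : 0 < δ) (hr : Integrable r μ)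
    (hr2 : Integrable (fun x => r x ^ 2) μ) (h2 : ∫ x, r x ^ 2 ∂μ ≤ (3 * δ) ^ 2) {k : ℕ}
    (hk : k < Nat.log 2 n) {V : ℕ → ℝ} (hV0 : ∀ j, 0 ≤ V j)
    (hV : ∀ j < 2 ^ k, ∀ x ∈ cell Q k j, ∀ y ∈ cell Q k j, |r x - r y| ≤ V j)
    (hV1 : ∑ j ∈ Finset.range (2 ^ k), V j ≤ 1) :
    ∑ j ∈ Finset.range (2 ^ k), |haarCoeff μ Q r k j| / √2 ^ k * |empHaar Q x n k j| ≤
      3 * (1 + √C) * T * √δ * min (√√δ * √√2 ^ k) (√√δ * √√2 ^ k)⁻¹ := by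
  have hs : (0 : ℝ) < √2 ^ k := by positivity
  refine sum_mul_le_min _ _ _ hT hC (Real.sqrt_pos.2 hδ) hs
    (mul_pos (Real.sqrt_pos.2 (Real.sqrt_pos.2 hδ)) (by positivity)) ?_ ?_
    (fun j _ => by positivity) (fun j _ => abs_nonneg _) ?_ ?_ ?_
  · rw [mul_pow, Real.sq_sqrt (Real.sqrt_nonneg _), ← pow_mul, mul_comm k 2, pow_mul,
      Real.sq_sqrt (Real.sqrt_nonneg _)]
  · rw [Finset.card_range, sqrt_two_pow_sq]
    push_cast
    rfl
  · rw [← Finset.sum_div]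
    gcongr
    exact (Finset.sum_le_sum fun j hj => hQ.abs_haarCoeff_le hr (Finset.mem_range.1 hj)
      (hV j (Finset.mem_range.1 hj)) (hV0 j)).trans hV1
  · rw [Real.sq_sqrt hδ.le]
    simp only [div_pow, sq_abs]
    rw [← Finset.sum_div, sqrt_two_pow_sq, div_le_iff₀ (by positivity)]
    refine (hQ.sum_haarCoeff_sq_le hr hr2 k).trans ?_
    rw [mul_comm]
    gcongr
  · rw [sqrt_two_pow_sq]
    exact hx.sum_pow_eight_le k hk

/-- The approximation error of the truncated Haar expansion on a good sample. -/
lemma IsGoodSample.sum_abs_sub_le [IsProbabilityMeasure μ] (hx : IsGoodSample C Q x n T)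
    (hQ : IsQuantile μ Q) (hT : 0 ≤ T) (hr : Integrable r μ) {V : ℕ → ℝ} (hV0 : ∀ j, 0 ≤ V j)
    (hV : ∀ j < 2 ^ Nat.log 2 n, ∀ x ∈ cell Q (Nat.log 2 n) j, ∀ y ∈ cell Q (Nat.log 2 n) j,
      |r x - r y| ≤ V j)
    (hV1 : ∑ j ∈ Finset.range (2 ^ Nat.log 2 n), V j ≤ 1) :
    ∑ i ∈ Finset.range n, |r (x i) - ∑ j ∈ Finset.range (2 ^ Nat.log 2 n),
      cellAvg μ Q r (Nat.log 2 n) j * (cell Q (Nat.log 2 n) j).indicator 1 (x i)| ≤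
      T * ((Nat.log 2 n : ℝ) + 1) := by
  set K := Nat.log 2 n
  calc _ ≤ ∑ i ∈ Finset.range n, ∑ j ∈ Finset.range (2 ^ K),
        V j * (cell Q K j).indicator 1 (x i) := by
        refine Finset.sum_le_sum fun i _ => ?_
        obtain ⟨j, hj, hij⟩ := hQ.exists_mem_cell (hx.mem i) K
        rw [hQ.sum_indicator_of_mem hj hij, hQ.sum_indicator_of_mem hj hij, abs_sub_comm]
        exact hQ.abs_sub_cellAvg_le hr hj fun y hy => hV j hj y hy _ hij
    _ = ∑ j ∈ Finset.range (2 ^ K), V j *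
        ∑ i ∈ Finset.range n, (cell Q K j).indicator 1 (x i) := by
        rw [Finset.sum_comm]
        simp only [Finset.mul_sum]
    _ ≤ ∑ j ∈ Finset.range (2 ^ K), V j * (T * ((K : ℝ) + 1)) :=
        Finset.sum_le_sum fun j hj =>
          mul_le_mul_of_nonneg_left (hx.count_le j (Finset.mem_range.1 hj)) (hV0 j)
    _ ≤ 1 * (T * ((K : ℝ) + 1)) := by
        rw [← Finset.sum_mul]
        gcongr
    _ = _ := one_mul _

lemma IsQuantile.cellAvg_zero [IsProbabilityMeasure μ] (hQ : IsQuantile μ Q) :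
    cellAvg μ Q r 0 0 = ∫ x, r x ∂μ := by
  have h : μ.restrict (Ioc (Q 0) (Q 1)) = μ :=
    Measure.restrict_eq_self_of_ae_mem (mem_ae_iff.2 hQ.measure_compl_eq_zero)
  simp [cellAvg, cell, h]

/-- On a good sample, the empirical process is of order `T * √δ` uniformly over functions of
variation at most one and `L²` norm of order `δ ≥ n ^ (-1/3)`. -/
lemma IsGoodSample.abs_sqrt_mul_sub_le [IsProbabilityMeasure μ] (hx : IsGoodSample C Q x n T)
    (hQ : IsQuantile μ Q) (hC : 0 ≤ C) (hT : 0 < T) (hr : Integrable r μ)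
    (hr2 : Integrable (fun x => r x ^ 2) μ) (h2 : ∫ x, r x ^ 2 ∂μ ≤ (3 * δ) ^ 2)
    (hV : ∀ k, ∃ V : ℕ → ℝ, (∀ j, 0 ≤ V j) ∧
      (∀ j < 2 ^ k, ∀ x ∈ cell Q k j, ∀ y ∈ cell Q k j, |r x - r y| ≤ V j) ∧
      ∑ j ∈ Finset.range (2 ^ k), V j ≤ 1)
    {m : ℝ} (hm : 0 < m) (hmn : m ^ 3 = n) (hδ : 1 / m ≤ δ) :
    |√n * ((1 / n) * ∑ i ∈ Finset.range n, r (x i) - ∫ x, r x ∂μ)| ≤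
      (3 * (1 + √C) * (2 * (1 + √√2) / (√√2 - 1)) + 2) * T * √δ := by
  have hn' : (0 : ℝ) < n := hmn ▸ by positivity
  have hn : 0 < n := by exact_mod_cast hn'
  have hδ0 : 0 < δ := lt_of_lt_of_le (by positivity) hδ
  set K := Nat.log 2 n with hK
  have hsn : (0 : ℝ) < √n := Real.sqrt_pos.2 hn'
  set R : ℝ → ℝ := fun y => r y - ∑ j ∈ Finset.range (2 ^ K),
      cellAvg μ Q r K j * (cell Q K j).indicator 1 y with hR
  have hexp : ∀ i, r (x i) = R (x i) + (∫ x, r x ∂μ + ∑ k ∈ Finset.range K,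
      ∑ j ∈ Finset.range (2 ^ k), haarCoeff μ Q r k j * haar Q k j (x i)) := by
    intro i
    have h0 : (cell Q 0 0).indicator (1 : ℝ → ℝ) (x i) = 1 := by
      have : x i ∈ cell Q 0 0 := by simpa [cell] using hx.mem i
      simp [this]
    simp only [hR]
    rw [hQ.sum_cellAvg_indicator hr, h0, hQ.cellAvg_zero]
    ring
  have hmain : √n * ((1 / n) * ∑ i ∈ Finset.range n, r (x i) - ∫ x, r x ∂μ) =
      (∑ i ∈ Finset.range n, R (x i)) / √n + ∑ k ∈ Finset.range K,
        ∑ j ∈ Finset.range (2 ^ k), haarCoeff μ Q r k j / √2 ^ k * empHaar Q x n k j := by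
    have e1 : ∑ i ∈ Finset.range n, r (x i) = ∑ i ∈ Finset.range n, R (x i) +
        (n * ∫ x, r x ∂μ + ∑ k ∈ Finset.range K, ∑ j ∈ Finset.range (2 ^ k),
          haarCoeff μ Q r k j * ∑ i ∈ Finset.range n, haar Q k j (x i)) := by
      rw [Finset.sum_congr rfl fun i _ => hexp i, Finset.sum_add_distrib, Finset.sum_add_distrib,
        Finset.sum_const, Finset.card_range, nsmul_eq_mul, Finset.sum_comm]
      simp only [Finset.mul_sum]
      congr 2
      exact Finset.sum_congr rfl fun k _ => Finset.sum_comm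
    have e2 : ∀ k j, haarCoeff μ Q r k j / √2 ^ k * empHaar Q x n k j =
        (haarCoeff μ Q r k j * ∑ i ∈ Finset.range n, haar Q k j (x i)) / √n := by
      intro k j
      have hs : (0 : ℝ) < √2 ^ k := by positivity
      rw [empHaar]
      field_simp
    simp only [e2, ← Finset.sum_div]
    rw [e1]
    have e3 : (n : ℝ) = √n * √n := (Real.mul_self_sqrt hn'.le).symm
    have e4 : √(n : ℝ) * (1 / n) = 1 / √n := by
      rw [eq_div_iff hsn.ne', mul_right_comm, ← e3]
      field_simp
    rw [mul_sub, ← mul_assoc, e4]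
    field_simp
    rw [sq, ← e3]
    ring
  have hrem : |(∑ i ∈ Finset.range n, R (x i)) / √n| ≤ 2 * T * √δ := by
    obtain ⟨V, hV0, hV2, hV1⟩ := hV K
    have h1 := (Finset.abs_sum_le_sum_abs _ _).trans (hx.sum_abs_sub_le hQ hT.le hr hV0 hV2 hV1)
    have hKm : (K : ℝ) + 1 ≤ 2 * m := by
      refine le_of_pow_le_pow_left₀ (n := 3) (by norm_num) (by positivity) ?_
      have h3 : (2 : ℝ) ^ K ≤ n := by exact_mod_cast Nat.pow_log_le_self 2 hn.ne'
      have := succ_pow_three_le K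
      rw [mul_pow, hmn]
      linarith
    have hm2 : √(n : ℝ) = m * √m := by
      rw [← hmn, show m ^ 3 = m ^ 2 * m by ring, Real.sqrt_mul (by positivity),
        Real.sqrt_sq hm.le]
    have hsm : 0 < √m := Real.sqrt_pos.2 hm
    have hδ2 : 1 / √m ≤ √δ := by
      rw [← Real.sqrt_one, ← Real.sqrt_div zero_le_one]
      exact Real.sqrt_le_sqrt hδ
    rw [abs_div, abs_of_pos hsn, hm2, div_le_iff₀ (by positivity)]
    calc _ ≤ T * ((K : ℝ) + 1) := h1
      _ ≤ T * (2 * m) := by gcongr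
      _ = 2 * T * (1 / √m) * (m * √m) := by field_simp
      _ ≤ _ := by gcongr
  have hβ : 1 < √√2 := by
    rw [Real.lt_sqrt zero_le_one, one_pow, Real.lt_sqrt zero_le_one]
    norm_num
  have hlev : |∑ k ∈ Finset.range K, ∑ j ∈ Finset.range (2 ^ k),
      haarCoeff μ Q r k j / √2 ^ k * empHaar Q x n k j| ≤
      3 * (1 + √C) * T * √δ * (2 * (1 + √√2) / (√√2 - 1)) := by
    calc _ ≤ ∑ k ∈ Finset.range K, ∑ j ∈ Finset.range (2 ^ k),
          |haarCoeff μ Q r k j| / √2 ^ k * |empHaar Q x n k j| := by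
          refine (Finset.abs_sum_le_sum_abs _ _).trans (Finset.sum_le_sum fun k _ =>
            (Finset.abs_sum_le_sum_abs _ _).trans_eq (Finset.sum_congr rfl fun j _ => ?_))
          rw [abs_mul, abs_div, abs_of_pos (a := √2 ^ k) (by positivity)]
      _ ≤ ∑ k ∈ Finset.range K, 3 * (1 + √C) * T * √δ *
          min (√√δ * √√2 ^ k) (√√δ * √√2 ^ k)⁻¹ := by
          refine Finset.sum_le_sum fun k hk => ?_
          obtain ⟨V, hV0, hV2, hV1⟩ := hV k
          exact hx.sum_haarCoeff_mul_le hQ hC hT hδ0 hr hr2 h2 (Finset.mem_range.1 hk) hV0 hV2 hV1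
      _ ≤ _ := by
          rw [← Finset.mul_sum]
          gcongr
          exact sum_min_inv_le hβ (Real.sqrt_pos.2 (Real.sqrt_pos.2 hδ0)) K
  rw [hmain]
  refine (abs_add_le _ _).trans ((add_le_add hrem hlev).trans_eq ?_)
  ring

end Chaining

section Densities

variable {a b : ℝ} {f f₀ : ℝ → ℝ}

lemma setIntegral_withDensity_ofReal_eq (hf₀ : InF a b f₀) (g : ℝ → ℝ) :
    ∫ x, g x ∂(volume.restrict (Icc a b)).withDensity (fun t => ENNReal.ofReal (f₀ t)) =
      ∫ x in Icc a b, g x * f₀ x := by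
  rw [integral_withDensity_eq_integral_toReal_smul₀ hf₀.2.1.aemeasurable.ennreal_ofReal
    (Filter.Eventually.of_forall fun x => ENNReal.ofReal_lt_top)]
  refine setIntegral_congr_fun measurableSet_Icc fun x hx => ?_
  simp only [smul_eq_mul]
  rw [ENNReal.toReal_ofReal (hf₀.1 x hx).le, mul_comm]

lemma measureReal_withDensity_ofReal_Ioc (hf₀ : InF a b f₀) {p q : ℝ} (hp : a ≤ p) (hpq : p ≤ q)
    (hq : q ≤ b) :
    ((volume.restrict (Icc a b)).withDensity (fun t => ENNReal.ofReal (f₀ t))).real (Ioc p q) =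
      ∫ t in p..q, f₀ t := by
  have hsub : Ioc p q ⊆ Icc a b := fun t ht => ⟨hp.trans ht.1.le, ht.2.trans hq⟩
  rw [measureReal_def, withDensity_apply _ measurableSet_Ioc,
    Measure.restrict_restrict measurableSet_Ioc, inter_eq_self_of_subset_left hsub,
    ← ofReal_integral_eq_lintegral_ofReal (hf₀.2.1.mono_set hsub), ENNReal.toReal_ofReal,
    intervalIntegral.integral_of_le hpq]
  · exact setIntegral_nonneg measurableSet_Ioc fun t ht => (hf₀.1 t (hsub ht)).le
  · exact (ae_restrict_iff' measurableSet_Ioc).2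
      (Filter.Eventually.of_forall fun t ht => (hf₀.1 t (hsub ht)).le)

lemma exists_isQuantile (hab : a ≤ b) (hf₀ : InF a b f₀) : ∃ Q : ℝ → ℝ,
    IsQuantile ((volume.restrict (Icc a b)).withDensity (fun t => ENNReal.ofReal (f₀ t))) Q ∧
      Monotone Q ∧ ∀ u, Q u ∈ Icc a b := by
  have hint : IntegrableOn f₀ (uIcc a b) := by rw [uIcc_of_le hab]; exact hf₀.2.1
  set G : ℝ → ℝ := fun x => ∫ t in a..x, f₀ t with hG
  have hcont : ContinuousOn G (Icc a b) := by
    rw [← uIcc_of_le hab]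
    exact intervalIntegral.continuousOn_primitive_interval hint
  have hG0 : G a = 0 := intervalIntegral.integral_same
  have hG1 : G b = 1 := by
    rw [← hf₀.2.2.1, integral_Icc_eq_integral_Ioc]
    exact intervalIntegral.integral_of_le hab
  have hii : ∀ p ∈ Icc a b, ∀ q ∈ Icc a b, IntervalIntegrable f₀ volume p q := fun p hp q hq =>
    (hf₀.2.1.mono_set (uIcc_subset_Icc hp hq)).intervalIntegrable
  have hGsub : ∀ p ∈ Icc a b, ∀ q ∈ Icc a b, ∫ t in p..q, f₀ t = G q - G p := fun p hp q hq => by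
    have ha := left_mem_Icc.2 hab
    rw [hG]
    exact (intervalIntegral.integral_interval_sub_left (hii a ha q hq) (hii a ha p hp)).symm
  have hGmono : MonotoneOn G (Icc a b) := fun p hp q hq hpq => by
    have h := measureReal_withDensity_ofReal_Ioc hf₀ hp.1 hpq hq.2
    rw [hGsub p hp q hq] at h
    linarith [measureReal_nonneg (μ := (volume.restrict (Icc a b)).withDensity
      (fun t => ENNReal.ofReal (f₀ t))) (s := Ioc p q)]
  have hex : ∀ u : Icc (0 : ℝ) 1, ∃ q ∈ Icc a b, G q = u := fun u => by
    have h := intermediate_value_Icc hab hcont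
    rw [hG0, hG1] at h
    exact h u.2
  choose q hq hGq using hex
  have hqmono : Monotone q := fun u v huv => by
    rcases huv.eq_or_lt with rfl | h
    · exact le_rfl
    · by_contra hcon
      have := hGmono (hq v) (hq u) (not_le.1 hcon).le
      rw [hGq, hGq] at this
      exact absurd h (not_lt.2 this)
  have hQmono : Monotone fun u => q (projIcc 0 1 zero_le_one u) :=
    hqmono.comp (monotone_projIcc _)
  refine ⟨fun u => q (projIcc 0 1 zero_le_one u), ⟨hQmono.monotoneOn _, fun u v hu huv hv => ?_⟩,
    hQmono, fun u => hq _⟩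
  have hu' : u ∈ Icc (0 : ℝ) 1 := ⟨hu, huv.trans hv⟩
  have hv' : v ∈ Icc (0 : ℝ) 1 := ⟨hu.trans huv, hv⟩
  rw [measureReal_withDensity_ofReal_Ioc hf₀ (hq _).1 (hQmono huv) (hq _).2,
    hGsub _ (hq _) _ (hq _), hGq, hGq, projIcc_of_mem _ hu', projIcc_of_mem _ hv']

lemma abs_sub_le_toReal_eVariationOn {g : ℝ → ℝ} {s : Set ℝ} (hg : eVariationOn g s ≠ ⊤) {x y : ℝ}
    (hx : x ∈ s) (hy : y ∈ s) : |g x - g y| ≤ (eVariationOn g s).toReal := by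
  rw [← Real.dist_eq]
  exact BoundedVariationOn.dist_le hg hx hy

lemma sum_toReal_eVariationOn_Icc_le {g : ℝ → ℝ} (hg : eVariationOn g (Icc a b) ≠ ⊤) {I : ℕ → ℝ}
    (hI : Monotone I) (hIab : ∀ i, I i ∈ Icc a b) (n : ℕ) :
    ∑ i ∈ Finset.range n, (eVariationOn g (Icc (I i) (I (i + 1)))).toReal ≤
      (eVariationOn g (Icc a b)).toReal := by
  have hle : ∀ i j, eVariationOn g (Icc (I i) (I j)) ≤ eVariationOn g (Icc a b) := fun i j =>
    eVariationOn.mono g (Icc_subset_Icc (hIab i).1 (hIab j).2)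
  rw [← ENNReal.toReal_sum fun i _ => ne_top_of_le_ne_top hg (hle i (i + 1)),
    eVariationOn.sum' g hI]
  exact ENNReal.toReal_mono hg (hle 0 n)

lemma abs_pfun_sub_le (hf₀ : InF a b f₀) (hf : InF a b f) {s : Set ℝ} (hs : s ⊆ Icc a b) {x y : ℝ}
    (hx : x ∈ s) (hy : y ∈ s) : |pfun f₀ f x - pfun f₀ f y| ≤
      1 / 2 * ((eVariationOn (fun t => Real.log (f t)) s).toReal +
        (eVariationOn (fun t => Real.log (f₀ t)) s).toReal) := by
  have h1 := abs_sub_le_toReal_eVariationOn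
    (ne_top_of_le_ne_top hf.2.2.2 (eVariationOn.mono _ hs)) hx hy
  have h2 := abs_sub_le_toReal_eVariationOn
    (ne_top_of_le_ne_top hf₀.2.2.2 (eVariationOn.mono _ hs)) hx hy
  have h3 := abs_half_log_ratio_sub_le (hf.1 x (hs hx)) (hf₀.1 x (hs hx)) (hf.1 y (hs hy))
    (hf₀.1 y (hs hy))
  exact h3.trans (by gcongr)

lemma one_le_Jfun (a b : ℝ) (f₀ f : ℝ → ℝ) : 1 ≤ Jfun a b f₀ f := by
  unfold Jfun
  have h1 := ENNReal.toReal_nonneg (a := eVariationOn (fun t => Real.log (f t)) (Icc a b))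
  have h2 := ENNReal.toReal_nonneg (a := eVariationOn (fun t => Real.log (f₀ t)) (Icc a b))
  linarith

lemma integrableOn_sq_sqrt_sub_sqrt (hf₀ : InF a b f₀) (hf : InF a b f) :
    IntegrableOn (fun t => (√(f t) - √(f₀ t)) ^ 2) (Icc a b) := by
  refine Integrable.mono' (hf.2.1.add hf₀.2.1) ?_ ?_
  · exact ((hf.2.1.aemeasurable.sqrt.sub hf₀.2.1.aemeasurable.sqrt).pow_const 2).aestronglyMeasurable
  · refine (ae_restrict_iff' measurableSet_Icc).2 (Filter.Eventually.of_forall fun t ht => ?_)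
    rw [Real.norm_of_nonneg (sq_nonneg _)]
    have h1 := Real.sq_sqrt (hf.1 t ht).le
    have h2 := Real.sq_sqrt (hf₀.1 t ht).le
    have h3 := mul_nonneg (Real.sqrt_nonneg (f t)) (Real.sqrt_nonneg (f₀ t))
    simp only [Pi.add_apply]
    nlinarith

lemma integral_pfun_sq_mul_le (hf₀ : InF a b f₀) (hf : InF a b f) :
    ∫ t in Icc a b, pfun f₀ f t ^ 2 * f₀ t ≤ 8 * hell a b f f₀ ^ 2 := by
  have h0 : 0 ≤ ∫ t in Icc a b, (√(f t) - √(f₀ t)) ^ 2 := integral_nonneg fun t => sq_nonneg _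
  have hae : ∀ {p : ℝ → Prop}, (∀ t ∈ Icc a b, p t) → ∀ᵐ t ∂volume.restrict (Icc a b), p t :=
    fun h => (ae_restrict_iff' measurableSet_Icc).2 (Filter.Eventually.of_forall h)
  calc _ ≤ ∫ t in Icc a b, 4 * (√(f t) - √(f₀ t)) ^ 2 :=
        integral_mono_of_nonneg
          (hae fun t ht => mul_nonneg (sq_nonneg _) (hf₀.1 t ht).le)
          ((integrableOn_sq_sqrt_sub_sqrt hf₀ hf).const_mul 4)
          (hae fun t ht => half_log_ratio_sq_mul_le (hf.1 t ht) (hf₀.1 t ht))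
    _ = _ := by
        rw [integral_const_mul, hell, Real.sq_sqrt (by positivity)]
        ring

lemma aestronglyMeasurable_pfun (hf₀ : InF a b f₀) (hf : InF a b f) :
    AEStronglyMeasurable (pfun f₀ f)
      ((volume.restrict (Icc a b)).withDensity (fun t => ENNReal.ofReal (f₀ t))) := by
  have h := hf.2.1.aemeasurable
  have h₀ := hf₀.2.1.aemeasurable
  have h1 : AEMeasurable (pfun f₀ f) (volume.restrict (Icc a b)) :=
    (Real.measurable_log.comp_aemeasurable ((h.add h₀).div (h₀.const_mul 2))).const_mul (1 / 2)
  exact h1.aestronglyMeasurable.mono_ac (withDensity_absolutelyContinuous _ _)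

lemma ae_withDensity_of_forall_mem {p : ℝ → Prop} (h : ∀ t ∈ Icc a b, p t) :
    ∀ᵐ t ∂(volume.restrict (Icc a b)).withDensity (fun t => ENNReal.ofReal (f₀ t)), p t :=
  (withDensity_absolutelyContinuous _ _).ae_le
    ((ae_restrict_iff' measurableSet_Icc).2 (Filter.Eventually.of_forall h))

lemma exists_abs_pfun_le (hf₀ : InF a b f₀) (hf : InF a b f) :
    ∃ B, ∀ t ∈ Icc a b, |pfun f₀ f t| ≤ B := by
  refine ⟨|pfun f₀ f a| + 1 / 2 * ((eVariationOn (fun t => Real.log (f t)) (Icc a b)).toReal +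
        (eVariationOn (fun t => Real.log (f₀ t)) (Icc a b)).toReal), fun t ht => ?_⟩
  have h := abs_pfun_sub_le hf₀ hf Subset.rfl ht (left_mem_Icc.2 (ht.1.trans ht.2))
  have := abs_sub_abs_le_abs_sub (pfun f₀ f t) (pfun f₀ f a)
  linarith

/-- Uniform bound for the empirical process on a good sample. -/
lemma IsGoodSample.abs_sqrt_mul_empProc_le {Ω : Type*} {X : ℕ → Ω → ℝ} {ω : Ω} {Q : ℝ → ℝ} {n : ℕ}
    {C T : ℝ}
    [IsProbabilityMeasure
      ((volume.restrict (Icc a b)).withDensity (fun t => ENNReal.ofReal (f₀ t)))]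
    (hf₀ : InF a b f₀) (hf : InF a b f) (hx : IsGoodSample C Q (fun i => X i ω) n T)
    (hQ : IsQuantile ((volume.restrict (Icc a b)).withDensity (fun t => ENNReal.ofReal (f₀ t))) Q)
    (hQmono : Monotone Q) (hQab : ∀ u, Q u ∈ Icc a b) (hC : 0 ≤ C) (hT : 0 < T) (hn : 0 < n)
    (hh : hell a b f f₀ > (n : ℝ) ^ (-(1 : ℝ) / 3) * Jfun a b f₀ f) :
    |√n * empProc a b f₀ n X (pfun f₀ f) ω| / (√(hell a b f f₀) * √(Jfun a b f₀ f)) ≤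
      (3 * (1 + √C) * (2 * (1 + √√2) / (√√2 - 1)) + 2) * T := by
  set μ := (volume.restrict (Icc a b)).withDensity (fun t => ENNReal.ofReal (f₀ t)) with hμ
  set J := Jfun a b f₀ f with hJ
  set h := hell a b f f₀ with hh'
  set D := 3 * (1 + √C) * (2 * (1 + √√2) / (√√2 - 1)) + 2
  have hJ1 : 1 ≤ J := one_le_Jfun a b f₀ f
  have hJ0 : 0 < J := by linarith
  have hn' : (0 : ℝ) < n := by exact_mod_cast hn
  have hm : 0 < (n : ℝ) ^ ((1 : ℝ) / 3) := by positivity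
  have hmn : ((n : ℝ) ^ ((1 : ℝ) / 3)) ^ 3 = n := by
    rw [← Real.rpow_natCast, ← Real.rpow_mul hn'.le]
    norm_num
  have hδ : 1 / (n : ℝ) ^ ((1 : ℝ) / 3) ≤ h / J := by
    rw [le_div_iff₀ hJ0, one_div, ← Real.rpow_neg hn'.le]
    rw [neg_div] at hh
    exact hh.le
  have hh0 : 0 < h := by
    refine lt_trans ?_ hh
    positivity
  set r : ℝ → ℝ := fun t => pfun f₀ f t / J with hr
  obtain ⟨B, hB⟩ := exists_abs_pfun_le hf₀ hf
  have hpm := aestronglyMeasurable_pfun hf₀ hf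
  have hpi : Integrable (pfun f₀ f) μ :=
    Integrable.of_bound hpm B (ae_withDensity_of_forall_mem hB)
  have hp2 : Integrable (fun t => pfun f₀ f t ^ 2) μ := by
    refine Integrable.of_bound (hpm.pow 2) (B ^ 2) (ae_withDensity_of_forall_mem fun t ht => ?_)
    rw [norm_pow]
    exact pow_le_pow_left₀ (norm_nonneg _) (hB t ht) 2
  have hri : Integrable r μ := hpi.div_const J
  have hr2 : Integrable (fun t => r t ^ 2) μ := by
    simp only [hr, div_pow]
    exact hp2.div_const _
  have hrint : ∫ t, r t ^ 2 ∂μ ≤ (3 * (h / J)) ^ 2 := by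
    simp only [hr, div_pow]
    rw [integral_div, setIntegral_withDensity_ofReal_eq hf₀, mul_pow, div_pow, ← mul_div_assoc]
    gcongr
    refine (integral_pfun_sq_mul_le hf₀ hf).trans ?_
    nlinarith [sq_nonneg h]
  have hV : ∀ k, ∃ V : ℕ → ℝ, (∀ j, 0 ≤ V j) ∧
      (∀ j < 2 ^ k, ∀ x ∈ cell Q k j, ∀ y ∈ cell Q k j, |r x - r y| ≤ V j) ∧
      ∑ j ∈ Finset.range (2 ^ k), V j ≤ 1 := by
    intro k
    set I : ℕ → ℝ := fun j => Q (j / 2 ^ k) with hI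
    have hImono : Monotone I := fun i j hij => hQmono (by gcongr)
    refine ⟨fun j => 1 / 2 *
      ((eVariationOn (fun t => Real.log (f t)) (Icc (I j) (I (j + 1)))).toReal +
        (eVariationOn (fun t => Real.log (f₀ t)) (Icc (I j) (I (j + 1)))).toReal) / J,
      fun j => by positivity, fun j _ x hx y hy => ?_, ?_⟩
    · have hcell : cell Q k j ⊆ Icc (I j) (I (j + 1)) := by
        simp only [hI, cell]
        push_cast
        exact Ioc_subset_Icc_self
      simp only [hr]
      rw [← sub_div, abs_div, abs_of_pos hJ0]
      gcongr
      exact abs_pfun_sub_le hf₀ hf (Icc_subset_Icc (hQab _).1 (hQab _).2) (hcell hx) (hcell hy)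
    · rw [← Finset.sum_div, ← Finset.mul_sum, Finset.sum_add_distrib, div_le_one hJ0]
      have h1 := sum_toReal_eVariationOn_Icc_le hf.2.2.2 hImono (fun _ => hQab _) (2 ^ k)
      have h2 := sum_toReal_eVariationOn_Icc_le hf₀.2.2.2 hImono (fun _ => hQab _) (2 ^ k)
      have h3 : J = 1 + (eVariationOn (fun t => Real.log (f t)) (Icc a b)).toReal +
        (eVariationOn (fun t => Real.log (f₀ t)) (Icc a b)).toReal := rfl
      linarith
  have hkey := hx.abs_sqrt_mul_sub_le hQ hC hT hri hr2 hrint hV hm hmn hδ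
  have hemp : empProc a b f₀ n X (pfun f₀ f) ω =
      J * ((1 / n) * ∑ i ∈ Finset.range n, r (X i ω) - ∫ x, r x ∂μ) := by
    simp only [hr]
    rw [integral_div, setIntegral_withDensity_ofReal_eq hf₀, ← Finset.sum_div, empProc]
    field_simp
  have hsh : 0 < √h := Real.sqrt_pos.2 hh0
  have hsJ : 0 < √J := Real.sqrt_pos.2 hJ0
  rw [div_le_iff₀ (by positivity), hemp, mul_left_comm, abs_mul, abs_of_pos hJ0]
  calc _ ≤ J * (D * T * √(h / J)) := by gcongr
    _ = D * T * (√h * √J) := by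
      rw [Real.sqrt_div hh0.le]
      nth_rewrite 1 [← Real.mul_self_sqrt hJ0.le]
      field_simp

end Densities

/-- Theorem `OutThm`: on the set where
`h(f,f₀) > n^{-1/3} J(f)`, the normalized empirical process
`|√n (Pₙ-P)(p_f)| / (h^{1/2}(f,f₀) J^{1/2}(f))` has uniform exponential
tails: there are constants `c, n₀, t₀` with, for all `n ≥ n₀`, `T ≥ t₀`,
outer probability of `{sup ≥ T}` at most `c·exp(-T/c²)`. -/
theorem stmt_8
    {Ω : Type*} [MeasurableSpace Ω] (ℙ : Measure Ω) [IsProbabilityMeasure ℙ]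
    (a b : ℝ) (hab : a < b)
    (f₀ : ℝ → ℝ) (hf₀ : InF a b f₀)
    (X : ℕ → Ω → ℝ) (hXmeas : ∀ i, Measurable (X i))
    (hXlaw : ∀ i, Measure.map (X i) ℙ =
      (MeasureTheory.volume.restrict (Set.Icc a b)).withDensity
        (fun t => ENNReal.ofReal (f₀ t)))
    (hXindep : ProbabilityTheory.iIndepFun (m := fun _ => Real.measurableSpace) X ℙ) :
    ∃ c > (0 : ℝ), ∃ n₀ : ℕ, ∃ t₀ : ℝ, ∀ n ≥ n₀, ∀ T ≥ t₀,
      ℙ.toOuterMeasure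
        {ω | ENNReal.ofReal T ≤
          ⨆ (f : ℝ → ℝ)
            (_ : InF a b f ∧ hell a b f f₀ > (n : ℝ) ^ (-(1 : ℝ)/3) * Jfun a b f₀ f),
            ENNReal.ofReal
              (|Real.sqrt n * empProc a b f₀ n X (pfun f₀ f) ω| /
                (Real.sqrt (hell a b f f₀) * Real.sqrt (Jfun a b f₀ f)))}
      ≤ ENNReal.ofReal (c * Real.exp (-(T / c ^ 2))) := by
  obtain ⟨C, hC, B, hB, hgood⟩ := exists_measureReal_not_isGoodSample_le
  obtain ⟨Q, hQ, hQmono, hQab⟩ := exists_isQuantile hab.le hf₀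
  have : IsProbabilityMeasure
      ((volume.restrict (Icc a b)).withDensity (fun t => ENNReal.ofReal (f₀ t))) :=
    isProbabilityMeasure_of_map_eq hXmeas hXlaw
  set D := 3 * (1 + √C) * (2 * (1 + √√2) / (√√2 - 1)) + 2 with hD
  have hβ : 1 < √√2 := by
    rw [Real.lt_sqrt zero_le_one, one_pow, Real.lt_sqrt zero_le_one]
    norm_num
  have hD2 : 2 ≤ D := by
    have : 0 < √√2 - 1 := by linarith
    have : 0 ≤ 3 * (1 + √C) * (2 * (1 + √√2) / (√√2 - 1)) := by positivity
    linarith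
  refine ⟨B + 2 * D, by positivity, 1, 4 * D, fun n hn T hT => ?_⟩
  have hT' : 2 ≤ T / (2 * D) := by
    rw [le_div_iff₀ (by positivity)]
    linarith
  have hT0 : 0 < T := by linarith
  have hsub : {ω | ENNReal.ofReal T ≤
          ⨆ (f : ℝ → ℝ)
            (_ : InF a b f ∧ hell a b f f₀ > (n : ℝ) ^ (-(1 : ℝ)/3) * Jfun a b f₀ f),
            ENNReal.ofReal
              (|Real.sqrt n * empProc a b f₀ n X (pfun f₀ f) ω| /
                (Real.sqrt (hell a b f f₀) * Real.sqrt (Jfun a b f₀ f)))} ⊆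
      {ω | ¬ IsGoodSample C Q (fun i => X i ω) n (T / (2 * D))} := by
    intro ω hω hx
    have hle : (⨆ (f : ℝ → ℝ)
            (_ : InF a b f ∧ hell a b f f₀ > (n : ℝ) ^ (-(1 : ℝ)/3) * Jfun a b f₀ f),
            ENNReal.ofReal
              (|Real.sqrt n * empProc a b f₀ n X (pfun f₀ f) ω| /
                (Real.sqrt (hell a b f f₀) * Real.sqrt (Jfun a b f₀ f)))) ≤
        ENNReal.ofReal (D * (T / (2 * D))) :=
      iSup₂_le fun f hf => ENNReal.ofReal_le_ofReal
        (hx.abs_sqrt_mul_empProc_le hf₀ hf.1 hQ hQmono hQab hC.le (by linarith) hn hf.2)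
    have h1 := (ENNReal.ofReal_le_ofReal_iff (by positivity)).1 (le_trans hω hle)
    have h2 : D * (T / (2 * D)) = T / 2 := by field_simp
    linarith
  have hBc : B ≤ B + 2 * D := by linarith
  have hexp : T / (B + 2 * D) ^ 2 ≤ T / (2 * D) := by
    gcongr
    nlinarith
  calc _ ≤ ℙ {ω | ¬ IsGoodSample C Q (fun i => X i ω) n (T / (2 * D))} := measure_mono hsub
    _ = ENNReal.ofReal (ℙ.real {ω | ¬ IsGoodSample C Q (fun i => X i ω) n (T / (2 * D))}) :=
        (ofReal_measureReal).symm
    _ ≤ _ := by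
        refine ENNReal.ofReal_le_ofReal
          ((hgood hXmeas hXlaw hXindep hQ hn hT').trans ?_)
        gcongr
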